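/- arXiv:2402.12268 — 7 statements merged into one kernel-verified Lean document; each statement's English description precedes it below -/
import Mathlib

section
/- For every positive integer d there exists v = v(d) > 0, and for every integer p ≥ d+1 there exists h = h(p,d) > 0, such that the following holds. Let F be a finite family of convex sets in ℝ^d, each containing an ellipsoid of volume 1, and assume that among any p members of F there exist d+1 whose intersection contains an ellipsoid of volume 1. Then F admits a quantitative fractional v-transversal φ with total weight Σ_E φ(E) < h; in particular, the quantitative fractional v-transversal number of F is less than h. -/
open MeasureTheory

/-- An ellipsoid in ℝ^d is the image of the closed Euclidean unit ball under an invertible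
affine transformation. -/
def IsEllipsoid {d : ℕ} (E : Set (EuclideanSpace ℝ (Fin d))) : Prop :=
  ∃ A : EuclideanSpace ℝ (Fin d) ≃ᵃ[ℝ] EuclideanSpace ℝ (Fin d),
    E = A '' Metric.closedBall 0 1

theorem exists_ramsey_number_finset (r : ℕ) :
    ∀ (κ : Type) [Finite κ] (m : ℕ), ∃ n : ℕ, ∀ (α : Type) [LinearOrder α] (X : Finset α),
      n ≤ X.card → ∀ c : Finset α → κ,
        ∃ S ⊆ X, S.card = m ∧ ∃ k, ∀ T ⊆ S, T.card = r → c T = k := by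
  induction r with
  | zero =>
    intro κ _ m
    refine ⟨m, fun α _ X hX c => ?_⟩
    obtain ⟨S, hS, hc⟩ := Finset.exists_subset_card_eq hX
    refine ⟨S, hS, hc, c ∅, fun T _ h => ?_⟩
    rw [Finset.card_eq_zero.1 h]
  | succ r ih =>
    intro κ _ m
    have inner : ∀ t : ℕ, ∃ n : ℕ, ∀ (α : Type) [LinearOrder α] (X : Finset α),
        n ≤ X.card → ∀ c : Finset α → κ, ∃ S ⊆ X, S.card = t ∧ ∃ g : α → κ, ∀ a ∈ S, ∀ T ⊆ S,
          (∀ b ∈ T, a < b) → T.card = r → c (insert a T) = g a := by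
      intro t
      induction t with
      | zero =>
        refine ⟨0, fun α _ X _ c => ⟨∅, by simp, by simp, fun a => c {a}, by simp⟩⟩
      | succ t iht =>
        obtain ⟨n₁, h₁⟩ := iht
        obtain ⟨n₂, h₂⟩ := ih κ n₁
        refine ⟨n₂ + 1, fun α _ X hX c => ?_⟩
        have hne : X.Nonempty := Finset.card_pos.1 (by omega)
        set a := X.min' hne with ha
        have haX : a ∈ X := X.min'_mem hne
        obtain ⟨S₂, hS₂, hc₂, k, hk⟩ := h₂ α (X.erase a)
          (by rw [Finset.card_erase_of_mem haX]; omega) (fun T => c (insert a T))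
        obtain ⟨S₁, hS₁, hc₁, g, hg⟩ := h₁ α S₂ hc₂.ge c
        have hlt : ∀ b ∈ S₁, a < b := fun b hb => by
          have := hS₂ (hS₁ hb)
          rw [Finset.mem_erase] at this
          exact lt_of_le_of_ne (X.min'_le b this.2) this.1.symm
        have haS : a ∉ S₁ := fun h => lt_irrefl _ (hlt a h)
        refine ⟨insert a S₁, ?_, by rw [Finset.card_insert_of_notMem haS, hc₁],
          fun b => if b = a then k else g b, ?_⟩
        · intro b hb
          rcases Finset.mem_insert.1 hb with rfl | hb
          · exact haX
          · exact Finset.mem_of_mem_erase (hS₂ (hS₁ hb))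
        · intro b hb T hT hbT hcT
          have haT : a ∉ T := fun h => by
            have h1 := hbT a h
            rcases Finset.mem_insert.1 hb with rfl | hb
            · exact lt_irrefl _ h1
            · exact lt_asymm h1 (hlt b hb)
          have hTS : T ⊆ S₁ := (Finset.subset_insert_iff_of_notMem haT).1 hT
          rcases Finset.mem_insert.1 hb with rfl | hb
          · simpa using hk T (hTS.trans hS₁) hcT
          · have : b ≠ a := (hlt b hb).ne'
            simpa [this] using hg b hb T hTS hbT hcT
    obtain ⟨n, hn⟩ := inner (Nat.card κ * m + 1)
    refine ⟨n, fun α _ X hX c => ?_⟩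
    obtain ⟨S, hS, hcS, g, hg⟩ := hn α X hX c
    have := Fintype.ofFinite κ
    classical
    obtain ⟨k, -, hk⟩ := Finset.exists_lt_card_fiber_of_mul_lt_card_of_maps_to
      (s := S) (t := Finset.univ) (f := g) (n := m) (fun _ _ => Finset.mem_univ _)
      (by rw [hcS, Finset.card_univ, Nat.card_eq_fintype_card]; omega)
    obtain ⟨S', hS', hcS'⟩ := Finset.exists_subset_card_eq hk.le
    refine ⟨S', (hS'.trans (Finset.filter_subset _ _)).trans hS, hcS', k, fun T hT hcT => ?_⟩
    have hne : T.Nonempty := Finset.card_pos.1 (by omega)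
    have hm := T.min'_mem hne
    have := Finset.mem_filter.1 (hS' (hT hm))
    rw [← this.2, ← hg _ this.1 (T.erase (T.min' hne)) (((Finset.erase_subset _ _).trans hT).trans
      (hS'.trans (Finset.filter_subset _ _))) (fun b hb => ?_) (by
        rw [Finset.card_erase_of_mem hm]; omega), Finset.insert_erase hm]
    exact T.min'_lt_of_mem_erase_min' hne hb

theorem exists_ramsey_number (r : ℕ) (κ : Type) [Finite κ] (m : ℕ) :
    ∃ n : ℕ, ∀ (α : Type) [LinearOrder α] (X : Finset α), n ≤ X.card →
      ∀ f : (Fin r → α) → κ, ∃ S ⊆ X, S.card = m ∧ ∃ k, ∀ a : Fin r → α,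
        StrictMono a → (∀ i, a i ∈ S) → f a = k := by
  classical
  obtain ⟨n, hn⟩ := exists_ramsey_number_finset r κ m
  refine ⟨max n r, fun α _ X hX f => ?_⟩
  obtain ⟨Y, -, hY⟩ := Finset.exists_subset_card_eq ((le_max_right n r).trans hX)
  obtain ⟨S, hS, hc, k, hk⟩ := hn α X ((le_max_left _ _).trans hX)
    (fun T => if h : T.card = r then f (T.orderEmbOfFin h) else f (Y.orderEmbOfFin hY))
  refine ⟨S, hS, hc, k, fun a ha haS => ?_⟩
  have hcard : (Finset.univ.image a).card = r := by
    rw [Finset.card_image_of_injective _ ha.injective]; simp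
  rw [← hk (Finset.univ.image a) (by intro x; simp; rintro i rfl; exact haS i) hcard, dif_pos hcard]
  congr 1
  exact Finset.orderEmbOfFin_unique hcard (by simp) ha

theorem exists_monochromatic_grid (m : ℕ) (κ : Type) [Finite κ] :
    ∃ N : ℕ, ∀ f : (Fin m → Fin N) → κ, ∃ u v : Fin m → Fin N, (∀ c, u c < v c) ∧
      ∃ k, ∀ ε : Fin m → Bool, f (fun c => if ε c then v c else u c) = k := by
  classical
  obtain ⟨ι, _, hι⟩ := Combinatorics.Line.exists_mono_in_high_dimension (Fin m → Bool) κ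
  have hle : ∀ (x : ι → Fin m → Bool) c, ∑ i, (x i c).toNat < Fintype.card ι + 1 := fun x c =>
    Nat.lt_succ_of_le ((Finset.sum_le_card_nsmul _ _ 1 fun i _ => Bool.toNat_le _).trans (by simp))
  refine ⟨Fintype.card ι + 1, fun f => ?_⟩
  obtain ⟨l, k, hk⟩ := hι (fun x => f fun c => ⟨∑ i, (x i c).toNat, hle x c⟩)
  have hval : ∀ (ε : Fin m → Bool) (c : Fin m) (i : ι),
      l ε i c = ((l.idxFun i).map fun a => a c).getD (ε c) := by
    intro ε c i
    rw [Combinatorics.Line.coe_apply]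
    cases l.idxFun i <;> rfl
  refine ⟨fun c => ⟨_, hle (l fun _ => false) c⟩, fun c => ⟨_, hle (l fun _ => true) c⟩,
    fun c => ?_, k, fun ε => ?_⟩
  · obtain ⟨i, hi⟩ := l.proper
    refine Fin.mk_lt_mk.2 (Finset.sum_lt_sum (fun j _ => ?_) ⟨i, Finset.mem_univ _, ?_⟩)
    · rw [hval, hval]
      cases l.idxFun j <;> simp
    · rw [hval, hval, hi]
      simp
  · rw [← hk ε]
    congr 1
    funext c
    cases hc : ε c <;> simp [hval, hc]

theorem exists_convexHull_inter_nonempty_of_cube {d : ℕ} {E : Type*} [NormedAddCommGroup E]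
    [InnerProductSpace ℝ E] [FiniteDimensional ℝ E] (hd : Module.finrank ℝ E = d)
    (z : (Fin (d + 1) → Bool) → E) :
    ∃ b, (convexHull ℝ {x | ∃ ε, ε b = false ∧ z ε = x} ∩
      convexHull ℝ {x | ∃ ε, ε b = true ∧ z ε = x}).Nonempty := by
  by_contra! hcon
  have hfin : ∀ (b : Fin (d + 1)) (e : Bool), {x | ∃ ε, ε b = e ∧ z ε = x}.Finite := fun b e =>
    (Set.finite_range z).subset (by rintro _ ⟨ε, -, rfl⟩; exact ⟨ε, rfl⟩)
  have hsep : ∀ b, ∃ (φ : E →L[ℝ] ℝ) (s : ℝ), (∀ ε, ε b = false → φ (z ε) < s) ∧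
      ∀ ε, ε b = true → s < φ (z ε) := by
    intro b
    obtain ⟨φ, s, t, h1, h2, h3⟩ := geometric_hahn_banach_compact_closed
      (convex_convexHull ℝ _) ((hfin b false).isCompact_convexHull ℝ) (convex_convexHull ℝ _)
      ((hfin b true).isCompact_convexHull ℝ).isClosed (Set.disjoint_iff_inter_eq_empty.2 (hcon b))
    exact ⟨φ, s, fun ε h => h1 _ (subset_convexHull ℝ _ ⟨ε, h, rfl⟩),
      fun ε h => h2.trans (h3 _ (subset_convexHull ℝ _ ⟨ε, h, rfl⟩))⟩
  choose φ s hφ₀ hφ₁ using hsep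
  have hdep : ¬ LinearIndependent ℝ (fun b => (φ b : E →ₗ[ℝ] ℝ)) := by
    intro h
    have := h.fintype_card_le_finrank
    rw [Fintype.card_fin, Subspace.dual_finrank_eq, hd] at this
    omega
  obtain ⟨g, hg, b₀, hb₀⟩ := Fintype.not_linearIndependent_iff.1 hdep
  have hsum : ∀ x, ∑ b, g b * φ b x = 0 := fun x => by
    have := LinearMap.congr_fun hg x
    simpa [LinearMap.sum_apply] using this
  have key : ∀ (ε : Fin (d + 1) → Bool), (∀ b, 0 < g b → ε b = true) →
      (∀ b, g b < 0 → ε b = false) →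
      0 < ∑ b, g b * (φ b (z ε) - s b) := by
    intro ε h1 h2
    refine Finset.sum_pos' (fun b _ => ?_) ⟨b₀, Finset.mem_univ _, ?_⟩
    · rcases lt_trichotomy (g b) 0 with h | h | h
      · have := hφ₀ b ε (h2 b h); nlinarith
      · simp [h]
      · have := hφ₁ b ε (h1 b h); nlinarith
    · rcases lt_or_gt_of_ne hb₀ with h | h
      · have := hφ₀ _ ε (h2 _ h); nlinarith
      · have := hφ₁ _ ε (h1 _ h); nlinarith
  have key' : ∀ (ε : Fin (d + 1) → Bool), (∀ b, 0 < g b → ε b = false) →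
      (∀ b, g b < 0 → ε b = true) →
      ∑ b, g b * (φ b (z ε) - s b) < 0 := by
    intro ε h1 h2
    rw [← neg_pos, ← Finset.sum_neg_distrib]
    refine Finset.sum_pos' (fun b _ => ?_) ⟨b₀, Finset.mem_univ _, ?_⟩
    · rcases lt_trichotomy (g b) 0 with h | h | h
      · have := hφ₁ b ε (h2 b h); nlinarith
      · simp [h]
      · have := hφ₀ b ε (h1 b h); nlinarith
    · rcases lt_or_gt_of_ne hb₀ with h | h
      · have := hφ₁ _ ε (h2 _ h); nlinarith
      · have := hφ₀ _ ε (h1 _ h); nlinarith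
  have h1 := key (fun b => decide (0 < g b)) (by simp) (by intro b hb; simp [hb.le])
  have h2 := key' (fun b => decide (g b < 0)) (by intro b hb; simp [hb.le]) (by simp)
  simp only [mul_sub, Finset.sum_sub_distrib, hsum] at h1 h2
  linarith

theorem exists_stdSimplex_forall_lt_sum {ι σ : Type*} [Fintype ι] [Fintype σ] [Nonempty ι]
    (M : σ → ι → ℝ) {β' β : ℝ} (hβ : β' < β)
    (h : ∀ m ∈ stdSimplex ℝ ι, ∃ s, β ≤ ∑ i, m i * M s i) :
    ∃ w ∈ stdSimplex ℝ σ, ∀ i, β' < ∑ s, w s * M s i := by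
  classical
  by_contra! hcon
  let Φ : (σ → ℝ) →ₗ[ℝ] (ι → ℝ) := ∑ s, (LinearMap.proj s).smulRight (M s)
  have hΦ : ∀ w i, Φ w i = ∑ s, w s * M s i := fun w i => by
    simp [Φ, LinearMap.sum_apply]
  have hUconv : Convex ℝ {u : ι → ℝ | ∀ i, β' < u i} := by
    have : {u : ι → ℝ | ∀ i, β' < u i} = Set.univ.pi fun _ => Set.Ioi β' := by
      ext; simp
    rw [this]
    exact convex_pi fun _ _ => convex_Ioi _
  have hUopen : IsOpen {u : ι → ℝ | ∀ i, β' < u i} := by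
    have : {u : ι → ℝ | ∀ i, β' < u i} = Set.univ.pi fun _ => Set.Ioi β' := by
      ext; simp
    rw [this]
    exact isOpen_set_pi Set.finite_univ fun _ _ => isOpen_Ioi
  obtain ⟨f, c, hf, hc⟩ := geometric_hahn_banach_open hUconv hUopen
    ((convex_stdSimplex ℝ σ).linear_image Φ) (by
      rw [Set.disjoint_left]
      rintro _ hu ⟨w, hw, rfl⟩
      obtain ⟨i, hi⟩ := hcon w hw
      have := hu i
      rw [hΦ] at this
      exact absurd this hi.not_gt)
  have hfsum : ∀ u : ι → ℝ, f u = ∑ i, u i * f (Pi.single i 1) := fun u => by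
    conv_lhs => rw [pi_eq_sum_univ' u]
    simp [map_sum]
  have hnonpos : ∀ i, f (Pi.single i 1) ≤ 0 := by
    intro i
    by_contra! hpos
    set a := f (Pi.single i 1)
    set b := f (fun _ => β) with hb
    have hmem : (fun _ => β) + (max 0 ((c - b) / a)) • Pi.single i (1 : ℝ) ∈
        {u : ι → ℝ | ∀ i, β' < u i} := by
      intro j
      have h0 : 0 ≤ max 0 ((c - b) / a) * (Pi.single i (1 : ℝ) : ι → ℝ) j :=
        mul_nonneg (le_max_left _ _) (by by_cases hj : j = i <;> simp [hj])
      simp only [Pi.add_apply, Pi.smul_apply, smul_eq_mul]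
      linarith
    have := hf _ hmem
    rw [map_add, map_smul, smul_eq_mul] at this
    have h1 : (c - b) / a * a ≤ max 0 ((c - b) / a) * a :=
      mul_le_mul_of_nonneg_right (le_max_right _ _) hpos.le
    rw [div_mul_cancel₀ _ hpos.ne'] at h1
    linarith
  have hσ : ∀ s, c ≤ f (M s) := fun s => hc _ ⟨Pi.single s 1, single_mem_stdSimplex ℝ s, by
    ext i; rw [hΦ]; simp [Pi.single_apply]⟩
  have hβc : f (fun _ => β) < c := hf _ fun _ => hβ
  set Z := ∑ i, - f (Pi.single i 1) with hZ
  have hZ0 : 0 ≤ Z := Finset.sum_nonneg fun i _ => by linarith [hnonpos i]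
  have hβZ : f (fun _ => β) = - (β * Z) := by
    rw [hfsum, hZ, Finset.mul_sum, ← Finset.sum_neg_distrib]; simp
  rcases hZ0.eq_or_lt with h0 | hpos
  · have hz : ∀ i, f (Pi.single i 1) = 0 := by
      have := (Finset.sum_eq_zero_iff_of_nonneg
        (s := Finset.univ) (f := fun i => - f (Pi.single i (1 : ℝ)))
        fun i _ => by linarith [hnonpos i]).1 h0.symm
      intro i; simpa using this i (Finset.mem_univ _)
    obtain ⟨s, -⟩ := h _ (single_mem_stdSimplex ℝ (Classical.arbitrary ι))
    have h1 := hσ s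
    rw [hfsum] at h1
    simp only [hz, mul_zero, Finset.sum_const_zero] at h1
    rw [hβZ, ← h0] at hβc
    linarith
  · obtain ⟨s, hs⟩ := h (fun i => - f (Pi.single i 1) / Z) ⟨fun i =>
      div_nonneg (by linarith [hnonpos i]) hpos.le, by
        rw [← Finset.sum_div, div_self hpos.ne']⟩
    have h1 := hσ s
    rw [hfsum] at h1
    have h2 : ∑ i, - f (Pi.single i 1) / Z * M s i = - (∑ i, M s i * f (Pi.single i 1)) / Z := by
      rw [← Finset.sum_neg_distrib, Finset.sum_div]
      exact Finset.sum_congr rfl fun i _ => by ring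
    rw [h2, le_div_iff₀ hpos] at hs
    linarith

theorem sum_pi_prod_eq_one {ι κ : Type*} [Fintype ι] [Fintype κ] [DecidableEq κ] {m : ι → ℝ}
    (hm : ∑ i, m i = 1) :
    ∑ t : κ → ι, ∏ k, m (t k) = 1 := by
  classical
  rw [← Fintype.piFinset_univ, ← Finset.prod_univ_sum]
  simp [hm]

theorem sum_pi_prod_comp_embedding {ι κ κ' : Type*} [Fintype ι] [Fintype κ] [Fintype κ']
    [DecidableEq κ] [DecidableEq κ'] {m : ι → ℝ} (hm : ∑ i, m i = 1) (e : κ' → κ)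
    (he : Function.Injective e) (g : (κ' → ι) → ℝ) :
    ∑ t : κ → ι, (∏ k, m (t k)) * g (t ∘ e) = ∑ s : κ' → ι, (∏ k, m (s k)) * g s := by
  classical
  rw [← (Equiv.piEquivPiSubtypeProd (fun k => k ∈ Set.range e) (fun _ => ι)).symm.sum_comp,
    Fintype.sum_prod_type]
  rw [← ((Equiv.ofInjective e he).arrowCongr (Equiv.refl ι)).symm.sum_comp
    (fun s : κ' → ι => (∏ k, m (s k)) * g s)]
  refine Finset.sum_congr rfl fun s _ => ?_
  have h1 : ∀ r, (∏ k, m (((Equiv.piEquivPiSubtypeProd (fun k => k ∈ Set.range e)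
      (fun _ => ι)).symm (s, r)) k)) = (∏ k, m (s k)) * ∏ k, m (r k) := by
    intro r
    rw [← Fintype.prod_subtype_mul_prod_subtype (fun k => k ∈ Set.range e)]
    congr 1
    · exact Finset.prod_congr (by ext; simp) fun k _ => by
        rw [Equiv.piEquivPiSubtypeProd_symm_apply, dif_pos k.2]
    · exact Finset.prod_congr (by ext; simp) fun k _ => by
        rw [Equiv.piEquivPiSubtypeProd_symm_apply, dif_neg k.2]
  have h2 : ∀ r, ((Equiv.piEquivPiSubtypeProd (fun k => k ∈ Set.range e)
      (fun _ => ι)).symm (s, r)) ∘ e =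
        ((Equiv.ofInjective e he).arrowCongr (Equiv.refl ι)).symm s := by
    intro r
    ext k
    simp [Equiv.piEquivPiSubtypeProd_symm_apply, Equiv.arrowCongr]
  simp only [h1, h2]
  rw [← Finset.sum_mul, ← Finset.mul_sum, sum_pi_prod_eq_one hm, mul_one]
  congr 1
  rw [← (Equiv.ofInjective e he).prod_comp]
  simp [Equiv.arrowCongr]

theorem exists_unique_norm_le {V : Type*} [NormedAddCommGroup V] [InnerProductSpace ℝ V]
    [FiniteDimensional ℝ V] {K : Set V} (hne : K.Nonempty) (hconv : Convex ℝ K)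
    (hcl : IsClosed K) :
    ∃ p ∈ K, (∀ y ∈ K, ‖p‖ ≤ ‖y‖) ∧ ∀ q ∈ K, ‖q‖ ≤ ‖p‖ → q = p := by
  have := FiniteDimensional.proper_real V
  obtain ⟨p, hp, hdist⟩ := hcl.exists_infDist_eq_dist hne 0
  have hmin : ∀ y ∈ K, ‖p‖ ≤ ‖y‖ := fun y hy => by
    have := Metric.infDist_le_dist_of_mem (x := (0 : V)) hy
    rwa [hdist, dist_zero_left, dist_zero_left] at this
  refine ⟨p, hp, hmin, fun q hq hle => ?_⟩
  have hmid := hmin _ (hconv hp hq (a := 1 / 2) (b := 1 / 2) (by norm_num) (by norm_num)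
    (by norm_num))
  rw [← smul_add, norm_smul] at hmid
  norm_num at hmid
  have hpar := parallelogram_law_with_norm ℝ p q
  have h0 : ‖p - q‖ = 0 := by
    nlinarith [norm_nonneg p, norm_nonneg q, norm_nonneg (p + q), norm_nonneg (p - q)]
  exact (sub_eq_zero.1 (norm_eq_zero.1 h0)).symm

theorem exists_forall_exists_mem_of_nonempty {V : Type*} [NormedAddCommGroup V]
    [InnerProductSpace ℝ V] [FiniteDimensional ℝ V] {D : ℕ} (hD : Module.finrank ℝ V = D)
    {ι : Type*} (X : ι → Set V) (hconv : ∀ i, Convex ℝ (X i)) (hcl : ∀ i, IsClosed (X i)) :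
    ∃ p : (Fin D → ι) → V, ∀ t : Fin (D + 1) → ι, (⋂ l, X (t l)).Nonempty →
      ∃ j, p (t ∘ j.succAbove) ∈ X (t j) := by
  classical
  have hex : ∀ s : Fin D → ι, ∃ p, (⋂ l, X (s l)).Nonempty → p ∈ ⋂ l, X (s l) ∧
      (∀ y ∈ ⋂ l, X (s l), ‖p‖ ≤ ‖y‖) ∧ ∀ q ∈ ⋂ l, X (s l), ‖q‖ ≤ ‖p‖ → q = p := by
    intro s
    by_cases h : (⋂ l, X (s l)).Nonempty
    · obtain ⟨p, hp⟩ := exists_unique_norm_le h (convex_iInter fun l => hconv _)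
        (isClosed_iInter fun l => hcl _)
      exact ⟨p, fun _ => hp⟩
    · exact ⟨0, fun h' => (h h').elim⟩
  choose p hp using hex
  refine ⟨p, fun t ht => ?_⟩
  obtain ⟨z, hz, hzmin, -⟩ := exists_unique_norm_le ht (convex_iInter fun l => hconv _)
    (isClosed_iInter fun l => hcl _)
  let F : Option (Fin (D + 1)) → Set V := fun o => o.elim (Metric.ball 0 ‖z‖) fun l => X (t l)
  have hempty : ¬ (⋂ o ∈ (Finset.univ : Finset (Option (Fin (D + 1)))), F o).Nonempty := by
    rintro ⟨y, hy⟩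
    simp only [Finset.mem_univ, Set.iInter_true, Set.mem_iInter] at hy
    have h1 : ‖y‖ < ‖z‖ := by simpa [F] using hy none
    exact absurd (hzmin y (Set.mem_iInter.2 fun l => hy (some l))) h1.not_ge
  have hhelly := mt (Convex.helly_theorem' (𝕜 := ℝ) (F := F) (s := Finset.univ) (by
    rintro (_ | l) -
    · exact convex_ball _ _
    · exact hconv _)) hempty
  push Not at hhelly
  obtain ⟨I, -, hIcard, hI⟩ := hhelly
  rw [hD] at hIcard
  have hnone : none ∈ I := by
    by_contra hn
    rw [← Set.not_nonempty_iff_eq_empty] at hI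
    refine hI ⟨z, Set.mem_iInter₂.2 ?_⟩
    rintro (_ | l) ho
    · exact (hn ho).elim
    · exact Set.mem_iInter.1 hz l
  obtain ⟨j, hj⟩ : ∃ j, some j ∉ I := by
    by_contra! hall
    have : I = Finset.univ := by
      ext o; cases o <;> simp [hnone, hall]
    rw [this] at hIcard
    simp at hIcard
  have hz' : z ∈ ⋂ l, X ((t ∘ j.succAbove) l) :=
    Set.mem_iInter.2 fun l => Set.mem_iInter.1 hz _
  obtain ⟨h1, h2, h3⟩ := hp (t ∘ j.succAbove) ⟨z, hz'⟩
  refine ⟨j, ?_⟩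
  have hle : ‖z‖ ≤ ‖p (t ∘ j.succAbove)‖ := by
    by_contra! hlt
    rw [← Set.not_nonempty_iff_eq_empty] at hI
    refine hI ⟨p (t ∘ j.succAbove), Set.mem_iInter₂.2 ?_⟩
    rintro (_ | l) ho
    · simpa [F] using hlt
    · have hlj : l ≠ j := by rintro rfl; exact hj ho
      obtain ⟨l', rfl⟩ := Fin.exists_succAbove_eq hlj
      exact Set.mem_iInter.1 h1 l'
  rw [← h3 z hz' hle]
  exact Set.mem_iInter.1 hz j

theorem exists_embedding_inter_nonempty {V ι : Type*} {D R : ℕ} (X : ι → Set V)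
    (hne : ∀ i, (X i).Nonempty)
    (h : ∀ S : Finset ι, S.card = R → ∃ J ⊆ S, J.card = D + 1 ∧ (⋂ i ∈ J, X i).Nonempty)
    (t : Fin (R * D + 1) → ι) :
    ∃ e : Fin (D + 1) ↪ Fin (R * D + 1), (⋂ l, X (t (e l))).Nonempty := by
  classical
  by_cases hc : R ≤ (Finset.univ.image t).card
  · obtain ⟨S, hS, hScard⟩ := Finset.exists_subset_card_eq hc
    obtain ⟨J, hJ, hJcard, x, hx⟩ := h S hScard
    have hpre : ∀ i : J, ∃ k, t k = i := fun i => by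
      simpa using hS (hJ i.2)
    choose k hk using hpre
    have hkinj : Function.Injective k := fun a b hab => Subtype.ext (by rw [← hk a, ← hk b, hab])
    refine ⟨(J.equivFinOfCardEq hJcard).symm.toEmbedding.trans ⟨k, hkinj⟩, x,
      Set.mem_iInter.2 fun l => ?_⟩
    have := Set.mem_iInter₂.1 hx _ ((J.equivFinOfCardEq hJcard).symm l).2
    rw [← hk] at this
    exact this
  · push Not at hc
    obtain ⟨i, -, hi⟩ := Finset.exists_lt_card_fiber_of_mul_lt_card_of_maps_to
      (s := Finset.univ) (t := Finset.univ.image t) (f := t) (n := D)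
      (fun a _ => Finset.mem_image_of_mem _ (Finset.mem_univ _)) (by
        rw [Finset.card_univ, Fintype.card_fin]
        exact Nat.lt_succ_of_le (Nat.mul_le_mul_right _ hc.le))
    obtain ⟨S, hS, hScard⟩ := Finset.exists_subset_card_eq (Nat.succ_le_of_lt hi)
    obtain ⟨x, hx⟩ := hne i
    refine ⟨(S.equivFinOfCardEq hScard).symm.toEmbedding.trans (Function.Embedding.subtype _), x,
      Set.mem_iInter.2 fun l => ?_⟩
    have := (Finset.mem_filter.1 (hS ((S.equivFinOfCardEq hScard).symm l).2)).2
    change x ∈ X (t _)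
    simpa [this] using hx

theorem exists_tuple_le_sum {V ι : Type*} [Fintype ι] {D R' : ℕ} (X : ι → Set V)
    [∀ i, DecidablePred (· ∈ X i)]
    (p : (Fin D → ι) → V)
    (hp : ∀ t : Fin (D + 1) → ι, (⋂ l, X (t l)).Nonempty → ∃ j, p (t ∘ j.succAbove) ∈ X (t j))
    (he : ∀ t : Fin R' → ι, ∃ e : Fin (D + 1) ↪ Fin R', (⋂ l, X (t (e l))).Nonempty)
    (m : ι → ℝ) (hm : m ∈ stdSimplex ℝ ι) :
    ∃ s, 1 / ((D + 1) * (Fintype.card (Fin (D + 1) ↪ Fin R') + 1) : ℝ) ≤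
      ∑ i, m i * if p s ∈ X i then 1 else 0 := by
  classical
  set N : ℝ := (Fintype.card (Fin (D + 1) ↪ Fin R') : ℝ) with hN
  have hN0 : 0 ≤ N := by positivity
  have hw : ∀ {n : ℕ} (t : Fin n → ι), 0 ≤ ∏ k, m (t k) := fun t =>
    Finset.prod_nonneg fun k _ => hm.1 _
  let g : (Fin (D + 1) → ι) → ℝ := fun s => if (⋂ l, X (s l)).Nonempty then 1 else 0
  have hg0 : ∀ s, 0 ≤ g s := fun s => by simp only [g]; split_ifs <;> norm_num
  set α : ℝ := ∑ s : Fin (D + 1) → ι, (∏ k, m (s k)) * g s with hα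
  have hα0 : 0 ≤ α := Finset.sum_nonneg fun s _ => mul_nonneg (hw s) (hg0 s)
  have h1 : 1 ≤ N * α := by
    have : N * α = ∑ e : Fin (D + 1) ↪ Fin R', ∑ t : Fin R' → ι, (∏ k, m (t k)) * g (t ∘ e) := by
      simp_rw [fun e : Fin (D + 1) ↪ Fin R' =>
        sum_pi_prod_comp_embedding hm.2 e e.injective g]
      rw [Finset.sum_const, Finset.card_univ, nsmul_eq_mul]
    rw [this, Finset.sum_comm, ← sum_pi_prod_eq_one (κ := Fin R') hm.2]
    refine Finset.sum_le_sum fun t _ => ?_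
    rw [← Finset.mul_sum]
    refine le_mul_of_one_le_right (hw t) ?_
    obtain ⟨e, he⟩ := he t
    have h2 : g (t ∘ e) = 1 := if_pos he
    rw [← h2]
    exact Finset.single_le_sum (f := fun e : Fin (D + 1) ↪ Fin R' => g (t ∘ e))
      (fun _ _ => hg0 _) (Finset.mem_univ e)
  have h2 : α ≤ (D + 1) * ∑ s : Fin D → ι, (∏ k, m (s k)) *
      ∑ i, m i * if p s ∈ X i then 1 else 0 := by
    have hj : ∀ j : Fin (D + 1), ∑ t : Fin (D + 1) → ι, (∏ k, m (t k)) *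
        (if p (t ∘ j.succAbove) ∈ X (t j) then (1 : ℝ) else 0) =
        ∑ s : Fin D → ι, (∏ k, m (s k)) * ∑ i, m i * if p s ∈ X i then 1 else 0 := by
      intro j
      rw [← (Fin.insertNthEquiv (fun _ => ι) j).sum_comp, Fintype.sum_prod_type, Finset.sum_comm]
      refine Finset.sum_congr rfl fun s _ => ?_
      rw [Finset.mul_sum]
      refine Finset.sum_congr rfl fun i _ => ?_
      rw [Fin.prod_univ_succAbove _ j]
      have : (fun k => (Fin.insertNthEquiv (fun _ => ι) j (i, s)) (j.succAbove k)) = s := by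
        funext k; simp
      have h3 : (Fin.insertNthEquiv (fun _ => ι) j (i, s)) ∘ j.succAbove = s := this
      rw [h3]
      simp
      ring_nf
    have : ((D : ℝ) + 1) * ∑ s : Fin D → ι, (∏ k, m (s k)) *
        ∑ i, m i * (if p s ∈ X i then 1 else 0) = ∑ j : Fin (D + 1),
        ∑ t : Fin (D + 1) → ι, (∏ k, m (t k)) *
        (if p (t ∘ j.succAbove) ∈ X (t j) then (1 : ℝ) else 0) := by
      simp_rw [hj]
      rw [Finset.sum_const, Finset.card_univ, nsmul_eq_mul, Fintype.card_fin]
      push_cast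
      rfl
    rw [this, Finset.sum_comm]
    refine Finset.sum_le_sum fun t _ => ?_
    rw [← Finset.mul_sum]
    refine mul_le_mul_of_nonneg_left ?_ (hw t)
    have hnn : ∀ j : Fin (D + 1), (0 : ℝ) ≤ if p (t ∘ j.succAbove) ∈ X (t j) then 1 else 0 :=
      fun j => by split_ifs <;> norm_num
    by_cases ht : (⋂ l, X (t l)).Nonempty
    · obtain ⟨j, hj⟩ := hp t ht
      have h3 : g t = if p (t ∘ j.succAbove) ∈ X (t j) then 1 else 0 := by
        rw [if_pos hj]; exact if_pos ht
      rw [h3]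
      exact Finset.single_le_sum (f := fun j : Fin (D + 1) =>
        if p (t ∘ j.succAbove) ∈ X (t j) then (1 : ℝ) else 0) (fun j _ => hnn j)
        (Finset.mem_univ j)
    · rw [show g t = 0 from if_neg ht]
      exact Finset.sum_nonneg fun j _ => hnn j
  by_contra! hcon
  set β : ℝ := 1 / ((D + 1) * (N + 1)) with hβ
  have h3 : ∑ s : Fin D → ι, (∏ k, m (s k)) * ∑ i, m i * (if p s ∈ X i then 1 else 0) ≤ β := by
    calc _ ≤ ∑ s : Fin D → ι, (∏ k, m (s k)) * β :=
          Finset.sum_le_sum fun s _ => mul_le_mul_of_nonneg_left (hcon s).le (hw s)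
      _ = β := by rw [← Finset.sum_mul, sum_pi_prod_eq_one hm.2, one_mul]
  have h4 : (D + 1 : ℝ) * β * (N + 1) = 1 := by rw [hβ]; field_simp
  have h5 : α ≤ (D + 1) * β := h2.trans (mul_le_mul_of_nonneg_left h3 (by positivity))
  have h6 : 0 < (D + 1 : ℝ) * β := by rw [hβ]; positivity
  nlinarith

theorem exists_fractional_transversal (V : Type*) [NormedAddCommGroup V]
    [InnerProductSpace ℝ V] [FiniteDimensional ℝ V] {D : ℕ} (hD : Module.finrank ℝ V = D)
    (R : ℕ) :
    ∃ h > (0 : ℝ), ∀ (ι : Type) [Fintype ι] (X : ι → Set V), (∀ i, Convex ℝ (X i)) →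
      (∀ i, (X i).Nonempty) →
      (∀ S : Finset ι, S.card = R → ∃ J ⊆ S, J.card = D + 1 ∧ (⋂ i ∈ J, X i).Nonempty) →
      ∃ (σ : Type) (_ : Fintype σ) (p : σ → V) (w : σ → ℝ), (∀ s, 0 ≤ w s) ∧ ∑ s, w s < h ∧
        ∀ i, ∃ S : Finset σ, (∀ s ∈ S, p s ∈ X i) ∧ 1 ≤ ∑ s ∈ S, w s := by
  classical
  set β : ℝ := 1 / ((D + 1) * (Fintype.card (Fin (D + 1) ↪ Fin (R * D + 1)) + 1) : ℝ) with hβ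
  have hβ0 : 0 < β := by rw [hβ]; positivity
  refine ⟨2 / β + 1, by positivity, fun ι _ X hconv hne hR => ?_⟩
  rcases isEmpty_or_nonempty ι with hι | hι
  · exact ⟨Empty, inferInstance, Empty.elim, Empty.elim, fun s => s.elim, by simp; positivity,
      fun i => hι.elim i⟩
  have hex : ∀ S : Finset ι, ∃ e : V, (⋂ i ∈ S, X i).Nonempty → e ∈ ⋂ i ∈ S, X i := fun S => by
    by_cases h : (⋂ i ∈ S, X i).Nonempty
    · exact ⟨h.some, fun _ => h.some_mem⟩
    · exact ⟨0, fun h' => (h h').elim⟩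
  choose e he using hex
  let X' : ι → Set V := fun i => convexHull ℝ (e '' {S | i ∈ S ∧ (⋂ i ∈ S, X i).Nonempty})
  have hsub : ∀ i, X' i ⊆ X i := fun i => convexHull_min (by
    rintro _ ⟨S, ⟨hiS, hS⟩, rfl⟩
    exact Set.mem_iInter₂.1 (he S hS) i hiS) (hconv i)
  have hcl : ∀ i, IsClosed (X' i) := fun i =>
    (((Set.toFinite _).image e).isCompact_convexHull ℝ).isClosed
  have hmem : ∀ S : Finset ι, (⋂ i ∈ S, X i).Nonempty → ∀ i ∈ S, e S ∈ X' i := fun S hS i hi =>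
    subset_convexHull ℝ _ ⟨S, ⟨hi, hS⟩, rfl⟩
  obtain ⟨p, hp⟩ := exists_forall_exists_mem_of_nonempty hD X' (fun i => convex_convexHull ℝ _) hcl
  obtain ⟨w, hw, hwi⟩ := exists_stdSimplex_forall_lt_sum
    (fun s i => if p s ∈ X' i then 1 else 0) (half_lt_self hβ0)
    (exists_tuple_le_sum X' p hp (exists_embedding_inter_nonempty X'
      (fun i => ⟨e {i}, hmem {i} (by simpa using hne i) i (Finset.mem_singleton_self i)⟩)
      (fun S hS => by
        obtain ⟨J, hJS, hJ, hJne⟩ := hR S hS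
        exact ⟨J, hJS, hJ, e J, Set.mem_iInter₂.2 (hmem J hJne)⟩)))
  refine ⟨Fin D → ι, inferInstance, p, fun s => 2 / β * w s,
    fun s => mul_nonneg (by positivity) (hw.1 s), ?_, fun i => 
    ⟨Finset.univ.filter fun s => p s ∈ X' i, fun s hs => hsub i (Finset.mem_filter.1 hs).2, ?_⟩⟩
  · rw [← Finset.mul_sum, hw.2]
    linarith
  · have := hwi i
    rw [← Finset.mul_sum, Finset.sum_filter]
    simp only [mul_ite, mul_one, mul_zero] at this
    calc (1 : ℝ) = 2 / β * (β / 2) := by field_simp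
      _ ≤ _ := mul_le_mul_of_nonneg_left this.le (by positivity)

theorem affineIndependent_smul_moment {d : ℕ} {δ : ℝ} (hδ : δ ≠ 0) (t : Fin (d + 1) → ℝ)
    (ht : Function.Injective t) :
    AffineIndependent ℝ fun k => δ • (WithLp.toLp 2 fun i : Fin d => t k ^ (i + 1 : ℕ) :
      EuclideanSpace ℝ (Fin d)) := by
  rw [affineIndependent_iff_of_fintype]
  intro w hw hsum k
  rw [Finset.weightedVSub_eq_linear_combination Finset.univ hw] at hsum
  have : w = 0 := by
    refine Matrix.eq_zero_of_forall_pow_sum_mul_pow_eq_zero ht fun i => ?_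
    refine Fin.cases ?_ (fun i => ?_) i
    · simpa using hw
    · have h1 := congrArg (fun x : EuclideanSpace ℝ (Fin d) => x i) hsum
      simp [WithLp.ofLp_sum, mul_left_comm _ δ, ← Finset.mul_sum, hδ] at h1
      simpa using h1
  rw [this]; rfl

theorem exists_points_closedBall_subset_convexHull (d s : ℕ) :
    ∃ (ω : Fin s → EuclideanSpace ℝ (Fin d)) (r : ℝ), 0 < r ∧ (∀ k, ‖ω k‖ ≤ 1) ∧
      ∀ S : Finset (Fin s), S.card = d + 1 →
        ∃ o, Metric.closedBall o r ⊆ convexHull ℝ (ω '' S) := by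
  classical
  let ν : Fin s → EuclideanSpace ℝ (Fin d) := fun k =>
    WithLp.toLp 2 fun i : Fin d => ((k : ℕ) : ℝ) ^ (i + 1 : ℕ)
  set δ : ℝ := 1 / (1 + ∑ k, ‖ν k‖) with hδ
  have hpos : 0 < 1 + ∑ k, ‖ν k‖ := by
    have : 0 ≤ ∑ k, ‖ν k‖ := Finset.sum_nonneg fun k _ => norm_nonneg _
    linarith
  have hδ0 : 0 < δ := by positivity
  let ω : Fin s → EuclideanSpace ℝ (Fin d) := fun k => δ • ν k
  have hball : ∀ S : Finset (Fin s), ∃ r : ℝ, 0 < r ∧ (S.card = d + 1 →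
      ∃ o, Metric.closedBall o r ⊆ convexHull ℝ (ω '' S)) := by
    intro S
    by_cases hS : S.card = d + 1
    · have hind : AffineIndependent ℝ (fun k => ω (S.orderEmbOfFin hS k)) :=
        affineIndependent_smul_moment hδ0.ne' (fun k => ((S.orderEmbOfFin hS k : Fin s) : ℝ))
          fun a b hab => (S.orderEmbOfFin hS).injective (Fin.ext (Nat.cast_injective (R := ℝ) hab))
      have hspan := hind.affineSpan_eq_top_iff_card_eq_finrank_add_one.2 (by simp)
      rw [← interior_convexHull_nonempty_iff_affineSpan_eq_top] at hspan
      obtain ⟨o, ho⟩ := hspan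
      obtain ⟨r, hr, hsub⟩ := Metric.mem_nhds_iff.1 (mem_interior_iff_mem_nhds.1 ho)
      refine ⟨r / 2, by positivity, fun _ => ⟨o, (Metric.closedBall_subset_ball
        (half_lt_self hr)).trans (hsub.trans (convexHull_mono ?_))⟩⟩
      rintro _ ⟨k, rfl⟩
      exact ⟨_, S.orderEmbOfFin_mem hS k, rfl⟩
    · exact ⟨1, one_pos, fun h => (hS h).elim⟩
  choose ρ hρ hρS using hball
  refine ⟨ω, Finset.univ.inf' Finset.univ_nonempty ρ, (Finset.lt_inf'_iff _).2 fun S _ => hρ S,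
    fun k => ?_, fun S hS => ?_⟩
  · rw [norm_smul, Real.norm_of_nonneg hδ0.le, hδ, div_mul_eq_mul_div, one_mul, div_le_one hpos]
    have := Finset.single_le_sum (f := fun k => ‖ν k‖) (fun _ _ => norm_nonneg _)
      (Finset.mem_univ k)
    linarith
  · obtain ⟨o, ho⟩ := hρS S hS
    exact ⟨o, (Metric.closedBall_subset_closedBall
      (Finset.inf'_le _ (Finset.mem_univ S))).trans ho⟩

theorem exists_orthonormalBasis_lowerTriangular {d : ℕ}
    (A : EuclideanSpace ℝ (Fin d) ≃ₗ[ℝ] EuclideanSpace ℝ (Fin d)) :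
    ∃ b : OrthonormalBasis (Fin d) ℝ (EuclideanSpace ℝ (Fin d)),
      (∀ i j, i < j → A (b j) i = 0) ∧ ∀ i, 0 < A (b i) i := by
  let e := EuclideanSpace.basisFun (Fin d) ℝ
  let f : Fin d → EuclideanSpace ℝ (Fin d) := fun i => LinearMap.adjoint (A : _ →ₗ[ℝ] _) (e i)
  have hf : ∀ i x, inner ℝ x (f i) = A x i := fun i x => by
    simp only [f]
    rw [LinearMap.adjoint_inner_right, real_inner_comm, ← OrthonormalBasis.repr_apply_apply]
    rfl
  have hind : LinearIndependent ℝ f := by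
    rw [Fintype.linearIndependent_iff]
    intro g hg i
    have h1 : inner ℝ (A.symm (e i)) (∑ k, g k • f k) = 0 := by rw [hg, inner_zero_right]
    simpa [inner_sum, inner_smul_right, hf, e] using h1
  let b := InnerProductSpace.gramSchmidtOrthonormalBasis (𝕜 := ℝ) (by simp) f
  refine ⟨b, fun i j hij => ?_, fun i => ?_⟩
  · rw [← hf]
    exact InnerProductSpace.gramSchmidtOrthonormalBasis_inv_triangular _ f hij
  · have hne := InnerProductSpace.gramSchmidt_ne_zero (𝕜 := ℝ) i hind
    have hpos := norm_pos_iff.2 hne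
    rw [← hf]
    simp only [b]
    rw [InnerProductSpace.gramSchmidtOrthonormalBasis_apply _ (by
      simp [InnerProductSpace.gramSchmidtNormed, hne])]
    rw [InnerProductSpace.gramSchmidtNormed, inner_smul_left]
    refine mul_pos (by simpa using hne) ?_
    rw [InnerProductSpace.gramSchmidt_def'' ℝ f i, inner_add_right, inner_sum,
      Finset.sum_eq_zero fun k hk => ?_, add_zero]
    · exact real_inner_self_pos.2 hne
    · rw [inner_smul_right, InnerProductSpace.gramSchmidt_orthogonal ℝ f
        (Finset.mem_Iio.1 hk).ne', mul_zero]

/-- Parameters of affine self-maps of `ℝ^d`: the image of the origin, and the columns of the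
linear part. -/
abbrev AffineParam (d : ℕ) : Type :=
  PiLp 2 fun _ : Option (Fin d) => EuclideanSpace ℝ (Fin d)

namespace AffineParam

variable {d : ℕ}

/-- The linear part of the affine map with given parameters. -/
noncomputable def linear (x : AffineParam d) :
    EuclideanSpace ℝ (Fin d) →ₗ[ℝ] EuclideanSpace ℝ (Fin d) :=
  (EuclideanSpace.basisFun (Fin d) ℝ).toBasis.constr ℝ fun j => x (some j)

theorem linear_apply (x : AffineParam d) (u : EuclideanSpace ℝ (Fin d)) :
    x.linear u = ∑ j, u j • x (some j) := by
  simp [linear, Module.Basis.constr_apply_fintype]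

/-- The affine map with given parameters. -/
noncomputable def eval (x : AffineParam d) (u : EuclideanSpace ℝ (Fin d)) :
    EuclideanSpace ℝ (Fin d) :=
  x none + x.linear u

theorem eval_add_smul (x y : AffineParam d) (a b : ℝ)
    (u : EuclideanSpace ℝ (Fin d)) :
    (a • x + b • y).eval u = a • x.eval u + b • y.eval u := by
  simp only [eval, linear_apply, PiLp.add_apply, PiLp.smul_apply, smul_add, Finset.smul_sum,
    Finset.sum_add_distrib, smul_comm _ a, smul_comm _ b]
  abel

/-- The parameters of lower triangular affine maps with positive diagonal whose determinant is at
least `κ`. -/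
def triangular (d : ℕ) (κ : ℝ) : Set (AffineParam d) :=
  {x | (∀ i j, i < j → x (some j) i = 0) ∧ (∀ i, 0 < x (some i) i) ∧
    Real.log κ ≤ ∑ i, Real.log (x (some i) i)}

/-- The parameters of lower triangular ellipsoids in `C`. -/
def ellipsoids (κ : ℝ) (C : Set (EuclideanSpace ℝ (Fin d))) : Set (AffineParam d) :=
  {x | x ∈ triangular d κ ∧ ∀ u ∈ Metric.closedBall 0 1, x.eval u ∈ C}

theorem ellipsoids_mono (κ : ℝ) {C C' : Set (EuclideanSpace ℝ (Fin d))} (h : C ⊆ C') :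
    ellipsoids κ C ⊆ ellipsoids κ C' := fun _ hx => ⟨hx.1, fun u hu => h (hx.2 u hu)⟩

theorem convex_triangular (κ : ℝ) : Convex ℝ (triangular d κ) := by
  rintro x ⟨hx, hx', hx''⟩ y ⟨hy, hy', hy''⟩ a b ha hb hab
  refine ⟨fun i j hij => by simp [hx i j hij, hy i j hij], fun i => ?_, ?_⟩
  · have := (convex_Ioi (0 : ℝ)) (hx' i) (hy' i) ha hb hab
    simpa using this
  · calc Real.log κ = a * Real.log κ + b * Real.log κ := by rw [← add_mul, hab, one_mul]
      _ ≤ a * ∑ i, Real.log (x (some i) i) + b * ∑ i, Real.log (y (some i) i) := by gcongr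
      _ = ∑ i, (a * Real.log (x (some i) i) + b * Real.log (y (some i) i)) := by
        rw [Finset.mul_sum, Finset.mul_sum, Finset.sum_add_distrib]
      _ ≤ _ := Finset.sum_le_sum fun i _ => by
        simpa using strictConcaveOn_log_Ioi.concaveOn.2 (hx' i) (hy' i) ha hb hab

theorem convex_ellipsoids (κ : ℝ) {C : Set (EuclideanSpace ℝ (Fin d))} (hC : Convex ℝ C) :
    Convex ℝ (ellipsoids κ C) := by
  rintro x ⟨hx, hx'⟩ y ⟨hy, hy'⟩ a b ha hb hab
  refine ⟨convex_triangular κ hx hy ha hb hab, fun u hu => ?_⟩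
  rw [eval_add_smul]
  exact hC (hx' u hu) (hy' u hu) ha hb hab

theorem det_linear {x : AffineParam d} (hx : ∀ i j, i < j → x (some j) i = 0) :
    LinearMap.det x.linear = ∏ i, x (some i) i := by
  have hentry : ∀ i j, LinearMap.toMatrix (EuclideanSpace.basisFun (Fin d) ℝ).toBasis
      (EuclideanSpace.basisFun (Fin d) ℝ).toBasis x.linear i j = x (some j) i := by
    intro i j
    rw [LinearMap.toMatrix_apply, linear, Module.Basis.constr_basis]
    simp
  rw [← LinearMap.det_toMatrix (EuclideanSpace.basisFun (Fin d) ℝ).toBasis,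
    Matrix.det_of_isLowerTriangular _ (fun i j hij => ?_)]
  · exact Finset.prod_congr rfl fun i _ => hentry i i
  · rw [hentry]; exact hx i j hij

theorem volume_eval_image {x : AffineParam d} (hx : ∀ i j, i < j → x (some j) i = 0)
    (hx' : ∀ i, 0 < x (some i) i) (s : Set (EuclideanSpace ℝ (Fin d))) :
    volume (x.eval '' s) = ENNReal.ofReal (∏ i, x (some i) i) * volume s := by
  have : x.eval '' s = (fun y => x none + y) '' (x.linear '' s) := by
    rw [Set.image_image]; rfl
  rw [this, Set.image_add_left, measure_preimage_add, Measure.addHaar_image_linearMap,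
    det_linear hx, abs_of_pos (Finset.prod_pos fun i _ => hx' i)]

/-- The parameters of the affine map `u ↦ A (o + r • b u)`, where the orthonormal basis `b` is
identified with the rotation taking the standard basis to it. -/
noncomputable def ofAffineEquiv (A : EuclideanSpace ℝ (Fin d) ≃ᵃ[ℝ] EuclideanSpace ℝ (Fin d))
    (b : OrthonormalBasis (Fin d) ℝ (EuclideanSpace ℝ (Fin d))) (o : EuclideanSpace ℝ (Fin d))
    (r : ℝ) : AffineParam d :=
  WithLp.toLp 2 fun k => k.elim (A o) fun j => r • A.linear (b j)

theorem eval_ofAffineEquiv (A : EuclideanSpace ℝ (Fin d) ≃ᵃ[ℝ] EuclideanSpace ℝ (Fin d))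
    (b : OrthonormalBasis (Fin d) ℝ (EuclideanSpace ℝ (Fin d))) (o : EuclideanSpace ℝ (Fin d))
    (r : ℝ) (u : EuclideanSpace ℝ (Fin d)) :
    (ofAffineEquiv A b o r).eval u = A (r • b.repr.symm u + o) := by
  have h := A.map_vadd o (r • b.repr.symm u)
  rw [vadd_eq_add, vadd_eq_add] at h
  rw [h, eval, linear_apply, ← b.sum_repr_symm, add_comm]
  simp [ofAffineEquiv, Finset.smul_sum, smul_comm r]

theorem exists_mem_ellipsoids {A : EuclideanSpace ℝ (Fin d) ≃ᵃ[ℝ] EuclideanSpace ℝ (Fin d)}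
    (hA : volume (A '' Metric.closedBall 0 1) = 1) (o : EuclideanSpace ℝ (Fin d)) {r : ℝ}
    (hr : 0 < r) :
    ∃ x, x ∈ ellipsoids
      (r ^ d / (volume (Metric.closedBall (0 : EuclideanSpace ℝ (Fin d)) 1)).toReal)
      (A '' Metric.closedBall o r) := by
  obtain ⟨b, hb, hb'⟩ := exists_orthonormalBasis_lowerTriangular A.linear
  have hball : (ofAffineEquiv A b 0 1).eval '' Metric.closedBall 0 1 =
      A '' Metric.closedBall 0 1 := by
    ext y
    constructor
    · rintro ⟨u, hu, rfl⟩
      exact ⟨b.repr.symm u, by simpa using hu, by simp [eval_ofAffineEquiv]⟩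
    · rintro ⟨u, hu, rfl⟩
      exact ⟨b.repr u, by simpa using hu, by simp [eval_ofAffineEquiv]⟩
  have hvol := volume_eval_image (x := ofAffineEquiv A b 0 1)
    (fun i j hij => by simpa [ofAffineEquiv] using hb i j hij)
    (fun i => by simpa [ofAffineEquiv] using hb' i) (Metric.closedBall 0 1)
  rw [hball, hA] at hvol
  have hprod : 0 < ∏ i, A.linear (b i) i := Finset.prod_pos fun i _ => hb' i
  have hdet : (∏ i, A.linear (b i) i) *
      (volume (Metric.closedBall (0 : EuclideanSpace ℝ (Fin d)) 1)).toReal = 1 := by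
    have := congrArg ENNReal.toReal hvol
    rw [ENNReal.toReal_mul] at this
    simp [ofAffineEquiv] at this
    rw [ENNReal.toReal_ofReal hprod.le] at this
    exact this.symm
  refine ⟨ofAffineEquiv A b o r, ⟨fun i j hij => ?_, fun i => ?_, ?_⟩, fun u hu =>
    ⟨r • b.repr.symm u + o, ?_, (eval_ofAffineEquiv ..).symm⟩⟩
  · simpa [ofAffineEquiv] using Or.inr (hb i j hij)
  · simpa [ofAffineEquiv] using mul_pos hr (hb' i)
  · have : ∏ i : Fin d, (ofAffineEquiv A b o r (some i)) i =
        r ^ d / (volume (Metric.closedBall (0 : EuclideanSpace ℝ (Fin d)) 1)).toReal := by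
      rw [eq_div_iff (right_ne_zero_of_mul_eq_one hdet)]
      simp only [ofAffineEquiv, Option.elim, PiLp.smul_apply, smul_eq_mul]
      rw [Finset.prod_mul_distrib, mul_assoc, hdet]
      simp
    rw [← this, Real.log_prod]
    intro i _
    simpa [ofAffineEquiv] using ⟨hr.ne', (hb' i).ne'⟩
  · simp only [Metric.mem_closedBall, dist_eq_norm, sub_zero, add_sub_cancel_right] at hu ⊢
    rw [norm_smul, Real.norm_of_nonneg hr.le]
    simpa using mul_le_mul_of_nonneg_left hu hr.le

theorem exists_isEllipsoid_subset (hd : 0 < d) {κ : ℝ} (hκ : 0 < κ) {x : AffineParam d}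
    (hx : x ∈ triangular d κ) :
    ∃ S, IsEllipsoid S ∧ volume S = ENNReal.ofReal
      (κ * (volume (Metric.closedBall (0 : EuclideanSpace ℝ (Fin d)) 1)).toReal) ∧
      S ⊆ x.eval '' Metric.closedBall 0 1 := by
  obtain ⟨h1, h2, h3⟩ := hx
  set P := ∏ i, x (some i) i with hP
  have hP0 : 0 < P := Finset.prod_pos fun i _ => h2 i
  have hκP : κ ≤ P := by
    rw [← Real.log_prod fun i _ => (h2 i).ne'] at h3
    exact (Real.log_le_log_iff hκ hP0).1 h3
  set c : ℝ := (κ / P) ^ (d : ℝ)⁻¹ with hc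
  have hc0 : 0 < c := Real.rpow_pos_of_pos (div_pos hκ hP0) _
  have hc1 : c ≤ 1 := Real.rpow_le_one (div_pos hκ hP0).le ((div_le_one hP0).2 hκP) (by positivity)
  have hcd : c ^ d = κ / P := Real.rpow_inv_natCast_pow (div_pos hκ hP0).le hd.ne'
  let y : AffineParam d := WithLp.toLp 2 fun k => k.elim (x none) fun j => c • x (some j)
  have hy : ∀ u, y.eval u = x.eval (c • u) := fun u => by
    simp [eval, linear_apply, y, smul_smul, Finset.smul_sum, mul_comm c]
  have hy1 : ∀ i j, i < j → y (some j) i = 0 := fun i j hij => by simp [y, h1 i j hij]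
  have hy2 : ∀ i, 0 < y (some i) i := fun i => by simpa [y] using mul_pos hc0 (h2 i)
  have hyP : ∏ i, y (some i) i = κ := by
    simp only [y, Option.elim, PiLp.smul_apply, smul_eq_mul]
    rw [Finset.prod_mul_distrib, Finset.prod_const, Finset.card_univ, Fintype.card_fin, hcd, ← hP,
      div_mul_cancel₀ _ hP0.ne']
  have hdet : LinearMap.det y.linear ≠ 0 := by rw [det_linear hy1, hyP]; exact hκ.ne'
  refine ⟨y.eval '' Metric.closedBall 0 1,
    ⟨(y.linear.equivOfDetNeZero hdet).toAffineEquiv.trans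
      (AffineEquiv.constVAdd ℝ _ (y none)), rfl⟩, ?_, ?_⟩
  · rw [volume_eval_image hy1 hy2, hyP, ENNReal.ofReal_mul hκ.le, ENNReal.ofReal_toReal
      measure_closedBall_lt_top.ne]
  · rintro _ ⟨u, hu, rfl⟩
    refine ⟨c • u, ?_, (hy u).symm⟩
    simp only [Metric.mem_closedBall, dist_zero_right] at hu ⊢
    rw [norm_smul, Real.norm_of_nonneg hc0.le]
    exact mul_le_one₀ hc1 (norm_nonneg _) hu

end AffineParam

theorem AffineParam.exists_forall_mem_ellipsoids_of_grid {d s q D N : ℕ} {κ : ℝ}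
    (hD : Module.finrank ℝ (AffineParam d) = D)
    (hN : ∀ f : (Fin q → Fin N) → Fin (D + 1) × Fin s, ∃ u v : Fin q → Fin N,
      (∀ c, u c < v c) ∧ ∃ k, ∀ ε : Fin q → Bool, f (fun c => if ε c then v c else u c) = k)
    (P : (Fin q → Fin N) → Fin s → EuclideanSpace ℝ (Fin d)) (Ω : Finset (Fin s))
    (y : (Fin q → Fin N) → AffineParam d)
    (hy : ∀ g, y g ∈ ellipsoids κ (convexHull ℝ (P g '' Ω))) {ι : Type*}
    (C : ι → Set (EuclideanSpace ℝ (Fin d))) (hC : ∀ i, Convex ℝ (C i))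
    (hbad : ∀ i, ∀ w ∈ Ω, ∀ u v : Fin q → Fin N, (∀ c, u c < v c) → (C i ∩ convexHull ℝ
      (Set.range fun ε : Fin q → Bool => P (fun c => if ε c then v c else u c) w)).Nonempty) :
    ∃ x, ∀ i, x ∈ ellipsoids κ (C i) := by
  classical
  let 𝓗 : Set (Set (EuclideanSpace ℝ (Fin d))) :=
    {H | Convex ℝ H ∧ Convex ℝ Hᶜ ∧ ∃ i, C i ⊆ H}
  let σ : Finset (Set (Fin q → Fin N)) :=
    Finset.univ.filter fun S => ∃ H ∈ 𝓗, S = {g | y g ∈ ellipsoids κ H}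
  obtain ⟨x, hx⟩ : (⋂ S ∈ σ, convexHull ℝ (y '' S)).Nonempty := by
    refine Convex.helly_theorem' (fun S _ => convex_convexHull ℝ _) fun I hI hIcard => ?_
    rw [hD] at hIcard
    suffices ∃ g, ∀ S ∈ I, g ∈ S by
      obtain ⟨g, hg⟩ := this
      exact ⟨y g, Set.mem_iInter₂.2 fun S hS => subset_convexHull ℝ _ ⟨g, hg S hS, rfl⟩⟩
    by_contra! hcon
    have hH : ∀ S : I, ∃ H ∈ 𝓗, (S : Set (Fin q → Fin N)) = {g | y g ∈ ellipsoids κ H} :=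
      fun S => (Finset.mem_filter.1 (hI S.2)).2
    choose H hH𝓗 hSH using hH
    have hw : ∀ g, ∃ (S : I) (w : Fin s), w ∈ Ω ∧ P g w ∉ H S := by
      intro g
      obtain ⟨S, hS, hgS⟩ := hcon g
      refine ⟨⟨S, hS⟩, ?_⟩
      by_contra! hall
      rw [show S = _ from hSH ⟨S, hS⟩] at hgS
      refine hgS (ellipsoids_mono κ (convexHull_min ?_ (hH𝓗 ⟨S, hS⟩).1) (hy g))
      rintro _ ⟨w, hw, rfl⟩
      exact hall w hw
    choose S w hwΩ hw using hw
    let e : I → Fin (D + 1) := fun S => Fin.castLE hIcard (I.equivFin S)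
    have he : Function.Injective e := (Fin.castLE_injective _).comp I.equivFin.injective
    obtain ⟨u, v, huv, ⟨l, w₀⟩, hmono⟩ := hN fun g => (e (S g), w g)
    let g₀ : Fin q → Fin N := fun c => if (fun _ => false : Fin q → Bool) c then v c else u c
    obtain ⟨-, hconv, i, hi⟩ := hH𝓗 (S g₀)
    have hmono' : ∀ ε : Fin q → Bool, P (fun c => if ε c then v c else u c) w₀ ∈ (H (S g₀))ᶜ := by
      intro ε
      have h1 := (hmono ε).trans (hmono fun _ => false).symm
      have h2 := hmono ε
      rw [Prod.mk.injEq] at h1 h2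
      have h3 := hw (fun c => if ε c then v c else u c)
      rw [he h1.1, h2.2] at h3
      exact h3
    obtain ⟨z, hz, hz'⟩ := hbad i w₀ (by
      have := hmono fun _ => false
      rw [Prod.mk.injEq] at this
      rw [← this.2]; exact hwΩ _) u v huv
    exact convexHull_min (by rintro _ ⟨ε, rfl⟩; exact hmono' ε) hconv hz' (hi hz)
  have hxH : ∀ H ∈ 𝓗, x ∈ ellipsoids κ H := fun H hH =>
    convexHull_min (by rintro _ ⟨g, hg, rfl⟩; exact hg) (convex_ellipsoids κ hH.1)
      (Set.mem_iInter₂.1 hx {g | y g ∈ ellipsoids κ H}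
        (Finset.mem_filter.2 ⟨Finset.mem_univ _, H, hH, rfl⟩))
  refine ⟨x, fun i => ⟨(hxH Set.univ
    ⟨convex_univ, by simpa using convex_empty, i, Set.subset_univ _⟩).1,
    fun u hu => ?_⟩⟩
  by_contra hne
  obtain ⟨H, hH, hHc, hsub, hsub'⟩ := exists_convex_convex_compl_subset (hC i)
    (convex_singleton (x.eval u)) (Set.disjoint_singleton_right.2 hne)
  exact hsub' rfl ((hxH H ⟨hH, hHc, i, hsub⟩).2 u hu)

theorem finProdFinEquiv_lt_iff {m n : ℕ} {p q : Fin m × Fin n} :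
    finProdFinEquiv p < finProdFinEquiv q ↔ p.1 < q.1 ∨ p.1 = q.1 ∧ p.2 < q.2 := by
  obtain ⟨⟨a, ha⟩, ⟨b, hb⟩⟩ := p
  obtain ⟨⟨a', ha'⟩, ⟨b', hb'⟩⟩ := q
  simp only [Fin.lt_def, finProdFinEquiv_apply_val, Fin.mk.injEq]
  rcases lt_trichotomy a a' with h | h | h
  · have : n * a + n ≤ n * a' := by nlinarith
    simp only [h, true_or, iff_true]
    omega
  · subst h; simp
  · have : n * a' + n ≤ n * a := by nlinarith
    constructor
    · intro; omega
    · rintro (h' | h') <;> omega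

theorem AffineParam.exists_number_common_ellipsoid {d s : ℕ} (κ : ℝ) (hs : (d + 1) * d < s)
    (k : ℕ) :
    ∃ n, ∀ (α : Type) [LinearOrder α] (X : Finset α), n ≤ X.card →
      ∀ (C : α → Set (EuclideanSpace ℝ (Fin d)))
        (P : (Fin (d + 1) → α) → Fin s → EuclideanSpace ℝ (Fin d)), (∀ i, Convex ℝ (C i)) →
      (∀ K, Function.Injective K → (∀ b, K b ∈ X) → (∀ b w, P K w ∈ C (K b)) ∧
        ∀ Ω : Finset (Fin s), Ω.card = d + 1 → ∃ y, y ∈ ellipsoids κ (convexHull ℝ (P K '' Ω))) →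
      ∃ I ⊆ X, I.card = k ∧ ∃ x, ∀ i ∈ I, x ∈ ellipsoids κ (C i) := by
  classical
  obtain ⟨N, hN⟩ := exists_monochromatic_grid (d + 1)
    (Fin (Module.finrank ℝ (AffineParam d) + 1) × Fin s)
  set L := N + k + 2 with hL
  obtain ⟨n, hn⟩ := exists_ramsey_number ((d + 1) * 2) (Set (Fin (d + 1) × Fin s)) ((d + 1) * L)
  refine ⟨n, fun α _ X hX C P hC hP => ?_⟩
  obtain ⟨S, hSX, hS, 𝓖, h𝓖⟩ := hn α X hX fun a => {bw | ¬ (C (a (finProdFinEquiv (bw.1, 0))) ∩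
    convexHull ℝ {x | ∃ ε : Fin (d + 1) → Bool, ε bw.1 = true ∧
      P (fun c => a (finProdFinEquiv (c, if ε c then 1 else 0))) bw.2 = x}).Nonempty}
  let pt : Fin (d + 1) → Fin L → α := fun c x => S.orderEmbOfFin hS (finProdFinEquiv (c, x))
  have hptS : ∀ c x, pt c x ∈ S := fun c x => S.orderEmbOfFin_mem hS _
  have hptinj : ∀ {c x c' x'}, pt c x = pt c' x' → c = c' ∧ x = x' := fun h =>
    Prod.mk.inj (finProdFinEquiv.injective ((S.orderEmbOfFin hS).injective h))
  have hPpt : ∀ g : Fin (d + 1) → Fin L, (∀ b w, P (fun c => pt c (g c)) w ∈ C (pt b (g b))) ∧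
      ∀ Ω : Finset (Fin s), Ω.card = d + 1 →
        ∃ y, y ∈ ellipsoids κ (convexHull ℝ (P (fun c => pt c (g c)) '' Ω)) := fun g =>
    hP (fun c => pt c (g c)) (fun c c' h => (hptinj h).1) fun b => hSX (hptS _ _)
  have hcolour : ∀ u v : Fin (d + 1) → Fin L, (∀ c, u c < v c) → ∀ b w, (b, w) ∈ 𝓖 ↔
      ¬ (C (pt b (u b)) ∩ convexHull ℝ {x | ∃ ε : Fin (d + 1) → Bool, ε b = true ∧
        P (fun c => pt c (if ε c then v c else u c)) w = x}).Nonempty := by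
    intro u v huv b w
    have := h𝓖 (fun p => pt (finProdFinEquiv.symm p).1 (if (finProdFinEquiv.symm p).2 = 1
      then v (finProdFinEquiv.symm p).1 else u (finProdFinEquiv.symm p).1)) ?_ fun _ => hptS _ _
    · rw [← this]
      simp only [Set.mem_ofPred_eq, Equiv.symm_apply_apply]
      have h2 : ∀ e : Bool, ((if e then 1 else 0 : Fin 2) = 1) = (e = true) := by decide
      simp [h2]
    · intro p p' hpp
      rw [← finProdFinEquiv.apply_symm_apply p, ← finProdFinEquiv.apply_symm_apply p',
        finProdFinEquiv_lt_iff] at hpp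
      refine (S.orderEmbOfFin hS).strictMono (finProdFinEquiv_lt_iff.2 (hpp.imp id ?_))
      rintro ⟨h1, h2⟩
      refine ⟨h1, ?_⟩
      have h3 : (finProdFinEquiv.symm p).2 = 0 ∧ (finProdFinEquiv.symm p').2 = 1 := by
        generalize (finProdFinEquiv.symm p).2 = e at h2
        generalize (finProdFinEquiv.symm p').2 = e' at h2
        revert e e'
        decide
      simp only [h3.1, h3.2, h1]
      simpa using huv _
  have hbad : ∀ w, ∃ b, (b, w) ∉ 𝓖 := by
    intro w
    let u : Fin (d + 1) → Fin L := fun _ => ⟨0, by omega⟩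
    let v : Fin (d + 1) → Fin L := fun _ => ⟨1, by omega⟩
    obtain ⟨b, z, hz, hz'⟩ := exists_convexHull_inter_nonempty_of_cube
      (E := EuclideanSpace ℝ (Fin d)) (d := d) (by simp)
      (fun ε => P (fun c => pt c (if ε c then v c else u c)) w)
    refine ⟨b, fun hb => (hcolour u v (fun _ => Fin.mk_lt_mk.2 one_pos) b w).1 hb
      ⟨z, convexHull_min ?_ (hC _) hz, hz'⟩⟩
    rintro _ ⟨ε, hε, rfl⟩
    have := (hPpt fun c => if ε c then v c else u c).1 b w
    simpa [hε] using this
  choose bad hbad using hbad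
  obtain ⟨b₀, -, hb₀⟩ := Finset.exists_lt_card_fiber_of_mul_lt_card_of_maps_to
    (s := Finset.univ) (t := Finset.univ) (f := bad) (n := d) (fun _ _ => Finset.mem_univ _)
    (by simpa using hs)
  obtain ⟨Ω, hΩ, hΩcard⟩ := Finset.exists_subset_card_eq (Nat.succ_le_of_lt hb₀)
  have hΩbad : ∀ w ∈ Ω, (b₀, w) ∉ 𝓖 := fun w hw => by
    have h1 := hbad w
    rwa [(Finset.mem_filter.1 (hΩ hw)).2] at h1
  let top : Fin L := ⟨k, by omega⟩
  let ext : (Fin (d + 1) → Fin N) → Fin (d + 1) → Fin L := fun g c =>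
    if c = b₀ then top else Fin.castLE (by omega) (g c)
  let low : Fin k → Fin L := Fin.castLE (by omega)
  choose y hy using fun g => (hPpt (ext g)).2 Ω hΩcard
  obtain ⟨x, hx⟩ := exists_forall_mem_ellipsoids_of_grid rfl hN
    (fun g => P fun c => pt c (ext g c)) Ω y hy (fun t : Fin k => C (pt b₀ (low t)))
    (fun _ => hC _) (fun t w hw u v huv => by
      have h1 := mt (hcolour (fun c => if c = b₀ then low t else Fin.castLE (by omega) (u c))
        (ext v) (fun c => by
          by_cases hc : c = b₀
          · simp only [hc, if_true, ext]
            exact Fin.lt_def.2 t.2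
          · simp only [hc, if_false, ext]
            exact Fin.lt_def.2 (Fin.lt_def.1 (huv c))) b₀ w).2 (hΩbad w hw)
      rw [not_not, if_pos rfl] at h1
      refine h1.mono (Set.inter_subset_inter_right _ (convexHull_mono ?_))
      rintro _ ⟨ε, hε, rfl⟩
      refine ⟨ε, ?_⟩
      simp only
      congr 1
      funext c
      by_cases hc : c = b₀
      · simp [hc, ext, hε]
      · cases h : ε c <;> simp [hc, ext, h])
  have hlowinj : Function.Injective fun t => pt b₀ (low t) := fun t t' h =>
    Fin.castLE_injective _ (hptinj h).2
  refine ⟨Finset.univ.image fun t => pt b₀ (low t), ?_, ?_, x, ?_⟩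
  · intro i hi
    obtain ⟨t, -, rfl⟩ := Finset.mem_image.1 hi
    exact hSX (hptS _ _)
  · rw [Finset.card_image_of_injective _ hlowinj, Finset.card_univ, Fintype.card_fin]
  · intro i hi
    obtain ⟨t, -, rfl⟩ := Finset.mem_image.1 hi
    exact hx t

theorem Finset.exists_sum_image_capped {σ β : Type*} [DecidableEq β] (e : σ → β)
    (G : Finset σ) {w : σ → ℝ} (hw : ∀ s, 0 ≤ w s) :
    ∃ w' : β → ℝ, (∀ b, w' b ∈ Set.Icc (0 : ℝ) 1) ∧ ∑ b ∈ G.image e, w' b ≤ ∑ s ∈ G, w s ∧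
      ∀ (q : β → Prop) [DecidablePred q], 1 ≤ ∑ s ∈ G with q (e s), w s →
        1 ≤ ∑ b ∈ G.image e, if q b then w' b else 0 := by
  let t : β → ℝ := fun b => ∑ s ∈ G with e s = b, w s
  have ht : ∀ b, 0 ≤ t b := fun b => Finset.sum_nonneg fun s _ => hw s
  refine ⟨fun b => min 1 (t b), fun b => ⟨le_min zero_le_one (ht b), min_le_left _ _⟩, ?_,
    fun q _ hq => ?_⟩
  · rw [← Finset.sum_fiberwise_of_maps_to (fun s hs => Finset.mem_image_of_mem e hs)]
    exact Finset.sum_le_sum fun b _ => min_le_right _ _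
  · have hnn : ∀ b, 0 ≤ if q b then min 1 (t b) else 0 := fun b => by
      split_ifs
      exacts [le_min zero_le_one (ht b), le_rfl]
    by_cases hcap : ∃ b ∈ G.image e, q b ∧ 1 ≤ t b
    · obtain ⟨b, hb, hqb, htb⟩ := hcap
      calc (1 : ℝ) = if q b then min 1 (t b) else 0 := by rw [if_pos hqb, min_eq_left htb]
        _ ≤ _ := Finset.single_le_sum (f := fun b => if q b then min 1 (t b) else 0)
          (fun b _ => hnn b) hb
    · push Not at hcap
      refine hq.trans (le_of_eq ?_)
      rw [Finset.sum_filter, ← Finset.sum_fiberwise_of_maps_to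
        (fun s hs => Finset.mem_image_of_mem e hs)]
      refine Finset.sum_congr rfl fun b hb => ?_
      by_cases hqb : q b
      · rw [if_pos hqb]
        change _ = min 1 (t b)
        rw [min_eq_right (hcap b hb hqb).le]
        exact Finset.sum_congr rfl fun s hs => by rw [(Finset.mem_filter.1 hs).2, if_pos hqb]
      · rw [if_neg hqb]
        exact Finset.sum_eq_zero fun s hs => by rw [(Finset.mem_filter.1 hs).2, if_neg hqb]

theorem AffineParam.exists_number_common_ellipsoid_of_property {d s : ℕ} {κ : ℝ}
    (hs : (d + 1) * d < s) {ω : Fin s → EuclideanSpace ℝ (Fin d)} (hω : ∀ w, ‖ω w‖ ≤ 1)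
    (hωκ : ∀ A : EuclideanSpace ℝ (Fin d) ≃ᵃ[ℝ] EuclideanSpace ℝ (Fin d),
      volume (A '' Metric.closedBall 0 1) = 1 → ∀ Ω : Finset (Fin s), Ω.card = d + 1 →
        ∃ y, y ∈ ellipsoids κ (convexHull ℝ (A '' (ω '' Ω)))) (p k : ℕ) :
    ∃ R, ∀ (α : Type) [LinearOrder α] (C : α → Set (EuclideanSpace ℝ (Fin d))),
      (∀ i, Convex ℝ (C i)) →
      (∀ P : Finset α, P.card = p → ∃ Q ⊆ P, Q.card = d + 1 ∧
        ∃ E, IsEllipsoid E ∧ volume E = 1 ∧ ∀ i ∈ Q, E ⊆ C i) →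
      ∀ S : Finset α, S.card = R →
        ∃ J ⊆ S, J.card = k ∧ (⋂ i ∈ J, ellipsoids κ (C i)).Nonempty := by
  classical
  obtain ⟨n, hn⟩ := exists_number_common_ellipsoid κ hs k
  obtain ⟨R, hR⟩ := exists_ramsey_number_finset (d + 1) Prop (max p n)
  refine ⟨R, fun α _ C hC hp S hS => ?_⟩
  obtain ⟨X, hXS, hX, b, hb⟩ := hR α S hS.ge fun T =>
    ∃ E, IsEllipsoid E ∧ volume E = 1 ∧ ∀ i ∈ T, E ⊆ C i
  have hcommon : ∀ T ⊆ X, T.card = d + 1 →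
      ∃ E, IsEllipsoid E ∧ volume E = 1 ∧ ∀ i ∈ T, E ⊆ C i := by
    obtain ⟨P, hPX, hP⟩ := Finset.exists_subset_card_eq ((le_max_left p n).trans hX.ge)
    obtain ⟨Q, hQP, hQ, hE⟩ := hp P hP
    intro T hT hTc
    have h1 := (hb T hT hTc).trans (hb Q (hQP.trans hPX) hQ).symm
    exact h1.mpr hE
  have hA : ∀ K : Fin (d + 1) → α,
      ∃ A : EuclideanSpace ℝ (Fin d) ≃ᵃ[ℝ] EuclideanSpace ℝ (Fin d),
      Function.Injective K → (∀ b, K b ∈ X) → volume (A '' Metric.closedBall 0 1) = 1 ∧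
        ∀ b, A '' Metric.closedBall 0 1 ⊆ C (K b) := by
    intro K
    by_cases h : Function.Injective K ∧ ∀ b, K b ∈ X
    · obtain ⟨_, ⟨A, rfl⟩, hvol, hsub⟩ := hcommon (Finset.univ.image K)
        (Finset.image_subset_iff.2 fun b _ => h.2 b)
        (by rw [Finset.card_image_of_injective _ h.1, Finset.card_univ, Fintype.card_fin])
      exact ⟨A, fun _ _ => ⟨hvol, fun b =>
        hsub _ (Finset.mem_image_of_mem K (Finset.mem_univ b))⟩⟩
    · exact ⟨AffineEquiv.refl ℝ _, fun h1 h2 => (h ⟨h1, h2⟩).elim⟩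
  choose A hA using hA
  obtain ⟨J, hJX, hJ, x, hx⟩ := hn α X ((le_max_right p n).trans hX.ge) C
    (fun K w => A K (ω w)) hC fun K hK hKX =>
      ⟨fun b w => (hA K hK hKX).2 b ⟨ω w, by simpa using hω w, rfl⟩, fun Ω hΩ => by
        simpa only [Set.image_image] using hωκ (A K) (hA K hK hKX).1 Ω hΩ⟩
  exact ⟨J, hJX.trans hXS, hJ, x, Set.mem_iInter₂.2 hx⟩

open scoped Classical in
/-- Bounded quantitative fractional v-transversal number for families satisfying a
quantitative (p, d+1) condition. -/
theorem bounded_fractional_transversal (d : ℕ) (hd : 0 < d) :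
    ∃ v > (0 : ℝ),
      ∀ p : ℕ, d + 1 ≤ p →
      ∃ h > (0 : ℝ),
      ∀ F : Finset (Set (EuclideanSpace ℝ (Fin d))),
        (∀ C ∈ F, Convex ℝ C ∧ ∃ E, IsEllipsoid E ∧ volume E = 1 ∧ E ⊆ C) →
        (∀ P ⊆ F, P.card = p →
          ∃ Q ⊆ P, Q.card = d + 1 ∧
            ∃ E, IsEllipsoid E ∧ volume E = 1 ∧
              E ⊆ ⋂₀ (Q : Set (Set (EuclideanSpace ℝ (Fin d))))) →
        ∃ (T : Finset (Set (EuclideanSpace ℝ (Fin d))))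
          (w : Set (EuclideanSpace ℝ (Fin d)) → ℝ),
          (∀ E ∈ T, IsEllipsoid E ∧ volume E = ENNReal.ofReal v) ∧
          (∀ E ∈ T, w E ∈ Set.Icc (0 : ℝ) 1) ∧
          (∀ C ∈ F, 1 ≤ ∑ E ∈ T, if E ⊆ C then w E else 0) ∧
          (∑ E ∈ T, w E) < h := by
  set s := (d + 1) * d + 1 with hs
  obtain ⟨ω, r, hr, hω, hωr⟩ := exists_points_closedBall_subset_convexHull d s
  set c := (volume (Metric.closedBall (0 : EuclideanSpace ℝ (Fin d)) 1)).toReal with hc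
  have hc0 : 0 < c := ENNReal.toReal_pos
    (Metric.measure_closedBall_pos volume _ one_pos).ne' measure_closedBall_lt_top.ne
  have hκ0 : 0 < r ^ d / c := by positivity
  have hωκ : ∀ A : EuclideanSpace ℝ (Fin d) ≃ᵃ[ℝ] EuclideanSpace ℝ (Fin d),
      volume (A '' Metric.closedBall 0 1) = 1 → ∀ Ω : Finset (Fin s), Ω.card = d + 1 →
        ∃ y, y ∈ AffineParam.ellipsoids (r ^ d / c) (convexHull ℝ (A '' (ω '' Ω))) := by
    intro A hA Ω hΩ
    obtain ⟨o, ho⟩ := hωr Ω hΩ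
    obtain ⟨y, hy⟩ := AffineParam.exists_mem_ellipsoids hA o hr
    refine ⟨y, AffineParam.ellipsoids_mono _ ?_ hy⟩
    have := A.toAffineMap.image_convexHull (ω '' Ω)
    rw [AffineEquiv.coe_toAffineMap] at this
    rw [← this]
    exact Set.image_mono ho
  refine ⟨r ^ d / c * c, by positivity, fun p _ => ?_⟩
  obtain ⟨R, hR⟩ := AffineParam.exists_number_common_ellipsoid_of_property (Nat.lt_succ_self _)
    hω hωκ p (Module.finrank ℝ (AffineParam d) + 1)
  obtain ⟨h, hh, htrans⟩ := exists_fractional_transversal (AffineParam d) rfl R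
  refine ⟨h, hh, fun F hF hFp => ?_⟩
  let C : Fin F.card → Set (EuclideanSpace ℝ (Fin d)) := fun i => F.equivFin.symm i
  have hCF : ∀ i, C i ∈ F := fun i => (F.equivFin.symm i).2
  have hCinj : Function.Injective C := Subtype.val_injective.comp F.equivFin.symm.injective
  obtain ⟨σ, _, x, w, hw0, hwh, hwC⟩ := htrans (Fin F.card)
    (fun i => AffineParam.ellipsoids (r ^ d / c) (C i))
    (fun i => AffineParam.convex_ellipsoids _ (hF _ (hCF i)).1)
    (fun i => by
      obtain ⟨hconv, _, ⟨A, rfl⟩, hvol, hsub⟩ := hF _ (hCF i)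
      obtain ⟨Ω, -, hΩ⟩ := Finset.exists_subset_card_eq (s := (Finset.univ : Finset (Fin s)))
        (n := d + 1) (by rw [Finset.card_univ, Fintype.card_fin, hs]; nlinarith)
      obtain ⟨y, hy⟩ := hωκ A hvol Ω hΩ
      refine ⟨y, AffineParam.ellipsoids_mono _ (convexHull_min ?_ hconv) hy⟩
      rintro _ ⟨_, ⟨k, -, rfl⟩, rfl⟩
      exact hsub ⟨ω k, by simpa using hω k, rfl⟩)
    (hR (Fin F.card) C (fun i => (hF _ (hCF i)).1) fun P hP => by
      obtain ⟨Q, hQP, hQ, E, hE, hvol, hsub⟩ := hFp (P.image C)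
        (Finset.image_subset_iff.2 fun i _ => hCF i)
        (by rw [Finset.card_image_of_injective _ hCinj, hP])
      obtain ⟨Q', hQ'P, rfl⟩ := Finset.subset_image_iff.1 hQP
      refine ⟨Q', hQ'P, by rwa [Finset.card_image_of_injective _ hCinj] at hQ, E, hE, hvol,
        fun i hi => hsub.trans (Set.sInter_subset_of_mem ?_)⟩
      exact Finset.mem_coe.2 (Finset.mem_image_of_mem C hi))
  have hell : ∀ t : σ, ∃ S : Set (EuclideanSpace ℝ (Fin d)),
      x t ∈ AffineParam.triangular d (r ^ d / c) → IsEllipsoid S ∧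
      volume S = ENNReal.ofReal (r ^ d / c * c) ∧ S ⊆ (x t).eval '' Metric.closedBall 0 1 := by
    intro t
    by_cases ht : x t ∈ AffineParam.triangular d (r ^ d / c)
    · obtain ⟨S, hS⟩ := AffineParam.exists_isEllipsoid_subset hd hκ0 ht
      exact ⟨S, fun _ => hS⟩
    · exact ⟨∅, fun h => (ht h).elim⟩
  choose E hE using hell
  let G : Finset σ := Finset.univ.filter fun t => x t ∈ AffineParam.triangular d (r ^ d / c)
  obtain ⟨w', hw', hsum, hcover⟩ := G.exists_sum_image_capped E hw0
  refine ⟨G.image E, w', fun S hS => ?_, fun S _ => hw' S, fun S hS => hcover (· ⊆ S) ?_,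
    (hsum.trans (Finset.sum_le_univ_sum_of_nonneg hw0)).trans_lt hwh⟩
  · obtain ⟨t, ht, rfl⟩ := Finset.mem_image.1 hS
    have := hE t (Finset.mem_filter.1 ht).2
    exact ⟨this.1, this.2.1⟩
  · obtain ⟨S', hS', h1⟩ := hwC (F.equivFin ⟨S, hS⟩)
    have hCS : C (F.equivFin ⟨S, hS⟩) = S := by simp [C]
    rw [hCS] at hS'
    refine h1.trans (Finset.sum_le_sum_of_subset_of_nonneg (fun t ht => ?_) fun t _ _ => hw0 t)
    obtain ⟨htri, hsub⟩ := hS' t ht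
    refine Finset.mem_filter.2 ⟨Finset.mem_filter.2 ⟨Finset.mem_univ _, htri⟩,
      (hE t htri).2.2.trans ?_⟩
    rintro _ ⟨u, hu, rfl⟩
    exact hsub u hu
end

section
/- For all positive integers d and N there exists δ0 = δ0(d,N) > 0 such that the following holds. Let C be a convex set in ℝ^d with diameter at least 1, and let S ⊆ ℝ^d be a union of at most N sets, each of diameter at most δ0. Then the diameter of C \ S is at least 1/2. -/
open scoped ENNReal

/-- If the endpoints of a segment in a convex set `C` are more than `3 / 4` apart, the initial
sixth of the segment is not covered by `N` sets of diameter at most `1 / (16 * N)`. -/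
theorem exists_lineMap_mem_diff_iUnion {E : Type*} [NormedAddCommGroup E] [NormedSpace ℝ E]
    {N : ℕ} (hN : 0 < N) {C : Set E} (hC : Convex ℝ C) {x y : E} (hx : x ∈ C) (hy : y ∈ C)
    (hxy : 3 / 4 < dist x y) (A : Fin N → Set E)
    (hA : ∀ i, Metric.ediam (A i) ≤ ENNReal.ofReal (1 / (16 * N))) :
    ∃ t : ℝ, 0 ≤ t ∧ t ≤ 1 / 6 ∧ AffineMap.lineMap x y t ∈ C \ ⋃ i, A i := by
  have hN' : (0 : ℝ) < N := by exact_mod_cast hN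
  by_contra! h
  have hmem : ∀ j : Fin (N + 1), ∃ i, AffineMap.lineMap x y ((j : ℝ) / (6 * N)) ∈ A i := by
    intro j
    have hj : (j : ℝ) ≤ N := by exact_mod_cast Nat.lt_succ_iff.mp j.2
    have h0 : (0 : ℝ) ≤ (j : ℝ) / (6 * N) := by positivity
    have h1 : (j : ℝ) / (6 * N) ≤ 1 / 6 := by
      rw [div_le_div_iff₀ (by positivity) (by norm_num)]
      linarith
    by_contra hne
    refine h _ h0 h1 ⟨hC.lineMap_mem hx hy ⟨h0, by linarith⟩, ?_⟩
    simpa using hne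
  choose f hf using hmem
  obtain ⟨a, b, hab, hfab⟩ := Fintype.exists_ne_map_eq_of_card_lt f (by simp)
  have hdist := (Metric.edist_le_ediam_of_mem (hf a) (hfab ▸ hf b)).trans (hA (f a))
  rw [edist_dist, ENNReal.ofReal_le_ofReal_iff (by positivity), dist_lineMap_lineMap,
    Real.dist_eq, ← sub_div, abs_div, abs_of_pos (show (0 : ℝ) < 6 * N by positivity)] at hdist
  have hone : (1 : ℝ) ≤ |(a : ℝ) - b| := by
    have hne : (a : ℤ) - b ≠ 0 := by
      intro h
      exact hab (Fin.ext (by omega))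
    exact_mod_cast Int.one_le_abs hne
  have hlow : 1 / (6 * (N : ℝ)) * (3 / 4) ≤ |(a : ℝ) - b| / (6 * N) * dist x y := by
    gcongr
  have hlt : 1 / (16 * (N : ℝ)) < 1 / (6 * (N : ℝ)) * (3 / 4) := by
    rw [div_mul_div_comm, div_lt_div_iff₀ (by positivity) (by positivity)]
    linarith
  linarith

/-- Removing a union of at most N sets of sufficiently small diameter from a convex set of
diameter at least 1 leaves a set of diameter at least 1/2. -/
theorem diam_remove_small_sets (d N : ℕ) (hd : 0 < d) (hN : 0 < N) :
    ∃ δ0 > (0 : ℝ),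
      ∀ C : Set (EuclideanSpace ℝ (Fin d)), Convex ℝ C → 1 ≤ EMetric.diam C →
      ∀ A : Fin N → Set (EuclideanSpace ℝ (Fin d)),
        (∀ i, EMetric.diam (A i) ≤ ENNReal.ofReal δ0) →
        (1 / 2 : ℝ≥0∞) ≤ EMetric.diam (C \ ⋃ i, A i) := by
  refine ⟨1 / (16 * N), by positivity, fun C hC hdiam A hA => ?_⟩
  obtain ⟨x, hx, y, hy, hxy⟩ : ∃ x ∈ C, ∃ y ∈ C, 3 / 4 < dist x y := by
    by_contra! h
    have hle : Metric.ediam C ≤ ENNReal.ofReal (3 / 4) := Metric.ediam_le fun x hx y hy => by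
      rw [edist_dist]
      exact ENNReal.ofReal_le_ofReal (h x hx y hy)
    have hone := hdiam.trans hle
    rw [ENNReal.one_le_ofReal] at hone
    norm_num at hone
  obtain ⟨t, -, ht, hpt⟩ := exists_lineMap_mem_diff_iUnion hN hC hx hy hxy A hA
  obtain ⟨s, -, hs, hps⟩ :=
    exists_lineMap_mem_diff_iUnion hN hC hy hx (by rwa [dist_comm]) A hA
  rw [← AffineMap.lineMap_apply_one_sub] at hps
  refine le_trans ?_ (Metric.edist_le_ediam_of_mem hpt hps)
  have hhalf : (1 / 2 : ℝ≥0∞) = ENNReal.ofReal (1 / 2) := by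
    rw [ENNReal.ofReal_div_of_pos (by norm_num)]
    simp
  rw [hhalf, edist_dist, dist_lineMap_lineMap, dist_comm t, Real.dist_eq]
  apply ENNReal.ofReal_le_ofReal
  have habs : 2 / 3 ≤ |1 - s - t| := le_trans (by linarith) (le_abs_self _)
  calc (1 / 2 : ℝ) = 2 / 3 * (3 / 4) := by norm_num
    _ ≤ |1 - s - t| * dist x y := by gcongr
end

section
/- (Colorful Helly theorem) Let d be a positive integer and let F_1, …, F_{d+1} be finite nonempty families of convex sets in ℝ^d such that A_1 ∩ … ∩ A_{d+1} ≠ ∅ for every colorful selection (A_1, …, A_{d+1}) ∈ F_1 × … × F_{d+1}. Then there exists an index i ∈ {1,…,d+1} such that the intersection of all members of F_i is nonempty. -/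
/-- **Colorful Helly theorem** for finite indexed families of closed convex sets. -/
theorem colorful_helly_of_isClosed {E : Type*} [NormedAddCommGroup E] [InnerProductSpace ℝ E]
    [FiniteDimensional ℝ E] {d : ℕ} (hd : Module.finrank ℝ E = d)
    {ι : Fin (d + 1) → Type*} [∀ i, Finite (ι i)] [∀ i, Nonempty (ι i)]
    (G : ∀ i, ι i → Set E) (hconv : ∀ i b, Convex ℝ (G i b)) (hclosed : ∀ i b, IsClosed (G i b))
    (hcolor : ∀ σ : ∀ i, ι i, (⋂ i, G i (σ i)).Nonempty) :
    ∃ i, (⋂ b, G i b).Nonempty := by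
  classical
  have : ProperSpace E := FiniteDimensional.proper_real E
  let K : Fin (d + 1) × (∀ i, ι i) → Set E := fun q => ⋂ j, ⋂ (_ : j ≠ q.1), G j (q.2 j)
  have hKclosed : ∀ q, IsClosed (K q) := fun q =>
    isClosed_iInter fun j => isClosed_iInter fun _ => hclosed _ _
  have hKconv : ∀ q, Convex ℝ (K q) := fun q =>
    convex_iInter fun j => convex_iInter fun _ => hconv _ _
  have hKne : ∀ q, (K q).Nonempty := fun q =>
    (hcolor q.2).mono fun y hy => Set.mem_iInter₂.2 fun j _ => Set.mem_iInter.1 hy j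
  obtain ⟨⟨i, σ⟩, hmax⟩ := Finite.exists_max fun q => Metric.infDist (0 : E) (K q)
  obtain ⟨x, hxK, hx⟩ := (hKclosed (i, σ)).exists_infDist_eq_dist (hKne _) 0
  rw [dist_zero_left] at hx
  refine ⟨i, x, Set.mem_iInter.2 fun b => ?_⟩
  let τ := Function.update σ i b
  let H : Option (Fin (d + 1)) → Set E := fun o =>
    o.elim (Metric.closedBall 0 ‖x‖) fun j => G j (τ j)
  have hH : (⋂ o ∈ (Finset.univ : Finset (Option (Fin (d + 1)))), H o).Nonempty := by
    refine Convex.helly_theorem (𝕜 := ℝ) (by simp [hd]) ?_ ?_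
    · rintro (_ | j) -
      · exact convex_closedBall _ _
      · exact hconv _ _
    · intro I _ hI
      obtain ⟨o, ho⟩ : ∃ o, o ∉ I := by
        by_contra! h
        have := Finset.card_le_card (fun o _ => h o : Finset.univ ⊆ I)
        simp [hI, hd] at this
      rcases o with _ | j
      · obtain ⟨y, hy⟩ := hcolor τ
        refine ⟨y, Set.mem_iInter₂.2 ?_⟩
        rintro (_ | k) hk
        · exact absurd hk ho
        · exact Set.mem_iInter.1 hy k
      · obtain ⟨z, hzK, hz⟩ := (hKclosed (j, τ)).exists_infDist_eq_dist (hKne _) 0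
        rw [dist_zero_left] at hz
        refine ⟨z, Set.mem_iInter₂.2 ?_⟩
        rintro (_ | k) hk
        · exact mem_closedBall_zero_iff.2 (hz ▸ hx ▸ hmax (j, τ))
        · exact Set.mem_iInter₂.1 hzK k (by rintro rfl; exact ho hk)
  obtain ⟨y, hy⟩ := hH
  simp only [Finset.mem_univ, Set.iInter_true, Set.mem_iInter] at hy
  have hyx : ‖y‖ ≤ ‖x‖ := mem_closedBall_zero_iff.1 (hy none)
  have hyG : ∀ j, y ∈ G j (τ j) := fun j => hy (some j)
  have hyK : y ∈ K (i, σ) := Set.mem_iInter₂.2 fun j hj => by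
    simpa [τ, Function.update_of_ne hj] using hyG j
  have hmin : ∀ z ∈ K (i, σ), ‖x‖ ≤ ‖z‖ := fun z hz => by
    simpa [hx] using Metric.infDist_le_dist_of_mem (x := (0 : E)) hz
  have hxy : x = y := by
    by_contra hne
    have hlt := (norm_midpoint_lt_iff (hyx.antisymm (hmin y hyK)).symm).2 hne
    refine hlt.not_ge (hmin _ ?_)
    rw [smul_add]
    exact hKconv _ hxK hyK (by norm_num) (by norm_num) (by norm_num)
  simpa [hxy, τ] using hyG i

/-- Colorful Helly theorem. -/
theorem colorful_helly (d : ℕ) (hd : 0 < d)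
    (F : Fin (d + 1) → Finset (Set (EuclideanSpace ℝ (Fin d))))
    (hne : ∀ i, (F i).Nonempty)
    (hconv : ∀ i, ∀ A ∈ F i, Convex ℝ A)
    (hcolor : ∀ A : Fin (d + 1) → Set (EuclideanSpace ℝ (Fin d)),
      (∀ i, A i ∈ F i) → (⋂ i, A i).Nonempty) :
    ∃ i, (⋂₀ ((F i : Finset (Set (EuclideanSpace ℝ (Fin d)))) :
      Set (Set (EuclideanSpace ℝ (Fin d))))).Nonempty := by
  have (i : Fin (d + 1)) : Nonempty (F i) := (hne i).to_subtype
  choose p hp using fun σ : ∀ i, F i => hcolor (fun i => σ i) fun i => (σ i).2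
  obtain ⟨i, x, hx⟩ := colorful_helly_of_isClosed finrank_euclideanSpace_fin
    (fun i (b : F i) => convexHull ℝ (p '' {σ | σ i = b}))
    (fun _ _ => convex_convexHull ℝ _)
    (fun _ _ => (Set.toFinite _).isClosed_convexHull ℝ)
    (fun σ => ⟨p σ, Set.mem_iInter.2 fun i => subset_convexHull ℝ _ ⟨σ, rfl, rfl⟩⟩)
  refine ⟨i, x, fun A hA => convexHull_min ?_ (hconv i A hA) (Set.mem_iInter.1 hx ⟨A, hA⟩)⟩
  rintro _ ⟨σ, hσ, rfl⟩
  have hmem := Set.mem_iInter.1 (hp σ) i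
  rwa [show σ i = ⟨A, hA⟩ from hσ] at hmem
end

section
/- (Quantitative Helly theorem) There exists an absolute constant c > 0 such that for every positive integer d the following holds. Let F be a finite family of at least 2d convex sets in ℝ^d such that vol(A_1 ∩ … ∩ A_{2d}) ≥ 1 for every 2d members A_1, …, A_{2d} of F. Then the intersection of all members of F has Lebesgue measure at least d^(−c·d). -/
open MeasureTheory

open Module Set

/-- A compact spanning set contains a basis (one of maximal determinant) with respect to which all
its points have coordinates in `[-1, 1]`. -/
theorem IsCompact.exists_basis_abs_repr_le_one {V : Type*} [NormedAddCommGroup V]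
    [NormedSpace ℝ V] [FiniteDimensional ℝ V] {N : Set V} (hN : IsCompact N)
    (hspan : Submodule.span ℝ N = ⊤) :
    ∃ b : Basis (Fin (finrank ℝ V)) ℝ V, (∀ i, b i ∈ N) ∧ ∀ a ∈ N, ∀ i, |b.repr a i| ≤ 1 := by
  let e := finBasis ℝ V
  have hcont : Continuous fun v : Fin (finrank ℝ V) → V => |e.det v| := by
    have h : Continuous fun v => (e.toMatrix v).det := by
      refine Continuous.matrix_det (continuous_matrix fun i j => ?_)
      exact (e.coord i).continuous_of_finiteDimensional.comp (continuous_apply j)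
    simpa only [Basis.det_apply] using h.abs
  obtain ⟨v₀, hv₀N, hv₀span, hv₀⟩ : ∃ f : Fin (finrank ℝ V) → V, (∀ i, f i ∈ N) ∧
      Submodule.span ℝ (range f) = ⊤ ∧ LinearIndependent ℝ f := by
    have h := Submodule.exists_fun_fin_finrank_span_eq ℝ N
    rwa [hspan, finrank_top] at h
  obtain ⟨v, hvN, hvmax⟩ := (isCompact_univ_pi fun _ : Fin (finrank ℝ V) => hN).exists_isMaxOn
    ⟨v₀, fun i _ => hv₀N i⟩ hcont.continuousOn
  have hdet₀ : e.det v₀ ≠ 0 := (e.is_basis_iff_det.mp ⟨hv₀, hv₀span⟩).ne_zero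
  have hdet : e.det v ≠ 0 := by
    have h : |e.det v₀| ≤ |e.det v| := hvmax fun i _ => hv₀N i
    exact abs_pos.mp ((abs_pos.mpr hdet₀).trans_le h)
  obtain ⟨hli, hsp⟩ := e.is_basis_iff_det.mpr (isUnit_iff_ne_zero.mpr hdet)
  refine ⟨Basis.mk hli hsp.ge, fun i => by simpa using hvN i (mem_univ i), fun a ha i => ?_⟩
  have h1 := congrArg (fun f => f a) (e.det_smul_mk_coord_eq_det_update hli hsp.ge i)
  have h2 : |e.det (Function.update v i a)| ≤ |e.det v| := by
    refine hvmax fun j _ => ?_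
    rcases eq_or_ne j i with rfl | hj
    · simpa using ha
    · simpa [hj] using hvN j (mem_univ j)
  have h3 : e.det v * (Basis.mk hli hsp.ge).repr a i = e.det (Function.update v i a) := by
    simpa using h1
  rw [← h3, abs_mul] at h2
  exact (mul_le_iff_le_one_right (abs_pos.mpr hdet)).mp h2

/-- Conic Carathéodory theorem with control of the total weight. -/
theorem exists_card_le_finrank_sum_smul_eq {E : Type*} [AddCommGroup E] [Module ℝ E]
    [FiniteDimensional ℝ E] (s : Finset E) (c : E → ℝ) (hc : ∀ y ∈ s, 0 ≤ c y) :
    ∃ t ⊆ s, t.card ≤ finrank ℝ E ∧ ∃ c' : E → ℝ, (∀ y ∈ t, 0 ≤ c' y) ∧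
      ∑ y ∈ t, c' y ≤ ∑ y ∈ s, c y ∧ ∑ y ∈ t, c' y • y = ∑ y ∈ s, c y • y := by
  classical
  induction s using Finset.strongInduction generalizing c with
  | H s ih =>
  by_cases hs : s.card ≤ finrank ℝ E
  · exact ⟨s, subset_rfl, hs, c, hc, le_rfl, rfl⟩
  obtain ⟨f, hf0, hfpos, hfsum⟩ : ∃ f : E → ℝ, ∑ y ∈ s, f y • y = 0 ∧ (∃ y ∈ s, 0 < f y) ∧
      0 ≤ ∑ y ∈ s, f y := by
    obtain ⟨f, hf0, y, hy, hfy⟩ := exists_nontrivial_relation_of_finrank_lt_card (not_le.mp hs)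
    rcases lt_trichotomy (∑ y ∈ s, f y) 0 with h | h | h
    · refine ⟨fun y => -f y, by simp [hf0], ?_, by simpa using h.le⟩
      simpa using Finset.exists_lt_of_sum_lt (s := s) (f := f) (g := fun _ => 0) (by simpa using h)
    · rcases hfy.lt_or_gt with h' | h'
      · exact ⟨fun y => -f y, by simp [hf0], ⟨y, hy, by simpa using h'⟩, by simp [h]⟩
      · exact ⟨f, hf0, ⟨y, hy, h'⟩, h.ge⟩
    · refine ⟨f, hf0, ?_, h.le⟩
      simpa using Finset.exists_lt_of_sum_lt (s := s) (f := fun _ => 0) (g := f) (by simpa using h)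
  obtain ⟨z, hz, hzmin⟩ := Finset.exists_min_image (s.filter fun y => 0 < f y)
    (fun y => c y / f y) (by obtain ⟨y, hy⟩ := hfpos; exact ⟨y, by simpa using hy⟩)
  obtain ⟨hzs, hfz⟩ := Finset.mem_filter.mp hz
  set r := c z / f z with hr
  have hr0 : 0 ≤ r := div_nonneg (hc z hzs) hfz.le
  have hcz : c z - r * f z = 0 := by rw [hr]; field_simp; simp
  have hc' : ∀ y ∈ s.erase z, 0 ≤ c y - r * f y := fun y hy => by
    have hys := Finset.mem_of_mem_erase hy
    rcases le_or_gt (f y) 0 with h | h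
    · nlinarith [hc y hys]
    · have := hzmin y (by simp [hys, h])
      rw [le_div_iff₀ h] at this
      linarith
  obtain ⟨t, hts, htcard, c', hc'0, hc'le, hc'eq⟩ :=
    ih _ (Finset.erase_ssubset hzs) (fun y => c y - r * f y) hc'
  refine ⟨t, hts.trans (Finset.erase_subset _ _), htcard, c', hc'0, hc'le.trans ?_, hc'eq.trans ?_⟩
  · rw [Finset.sum_erase (f := fun y => c y - r * f y) _ hcz, Finset.sum_sub_distrib,
      ← Finset.mul_sum]
    linarith [mul_nonneg hr0 hfsum]
  · rw [Finset.sum_erase _ (by simp [hcz])]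
    simp only [sub_smul, mul_smul, Finset.sum_sub_distrib, ← Finset.smul_sum, hf0, smul_zero,
      sub_zero]

/-- In a set containing the origin, `d` points suffice to represent a point of the convex hull as
a nonnegative combination of total weight at most one. -/
theorem mem_convexHull_iff_exists_fin_finrank {E : Type*} [AddCommGroup E] [Module ℝ E]
    [FiniteDimensional ℝ E] {N : Set E} (h0 : (0 : E) ∈ N) {x : E} :
    x ∈ convexHull ℝ N ↔ ∃ (c : Fin (finrank ℝ E) → ℝ) (w : Fin (finrank ℝ E) → E),
      (∀ i, 0 ≤ c i) ∧ ∑ i, c i ≤ 1 ∧ (∀ i, w i ∈ N) ∧ ∑ i, c i • w i = x := by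
  classical
  constructor
  · intro hx
    rw [convexHull_eq_union_convexHull_finite_subsets] at hx
    simp only [mem_iUnion] at hx
    obtain ⟨s, hsN, hx⟩ := hx
    rw [Finset.mem_convexHull'] at hx
    obtain ⟨c, hc0, hc1, rfl⟩ := hx
    obtain ⟨t, hts, htcard, c', hc'0, hc'le, hc'eq⟩ := exists_card_le_finrank_sum_smul_eq s c hc0
    obtain ⟨e⟩ : Nonempty (t ↪ Fin (finrank ℝ E)) :=
      Function.Embedding.nonempty_of_card_le (by simpa using htcard)
    refine ⟨Function.extend e (fun y => c' y) 0, Function.extend e (fun y => (y : E)) 0,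
      fun i => ?_, ?_, fun i => ?_, ?_⟩
    · by_cases hi : ∃ y, e y = i
      · obtain ⟨y, rfl⟩ := hi
        simpa [e.injective.extend_apply] using hc'0 y y.2
      · simp [Function.extend_apply' _ _ _ hi]
    · rw [← Fintype.sum_of_injective e e.injective (fun y : t => c' y) _
        (fun i hi => by rw [Function.extend_apply' _ _ _ hi]; rfl)
        (fun y => by rw [e.injective.extend_apply]), Finset.sum_coe_sort t c']
      exact hc'le.trans hc1.le
    · by_cases hi : ∃ y, e y = i
      · obtain ⟨y, rfl⟩ := hi
        simpa [e.injective.extend_apply] using hsN (hts y.2)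
      · simpa [Function.extend_apply' _ _ _ hi] using h0
    · rw [← Fintype.sum_of_injective e e.injective (fun y : t => c' y • (y : E)) _
        (fun i hi => by rw [Function.extend_apply' _ _ _ hi]; simp)
        (fun y => by rw [e.injective.extend_apply, e.injective.extend_apply]),
        Finset.sum_coe_sort t fun y => c' y • y, hc'eq]
  · rintro ⟨c, w, hc0, hc1, hw, rfl⟩
    have h := (convex_convexHull ℝ N).sum_mem (t := Finset.univ)
      (w := fun o : Option (Fin (finrank ℝ E)) => o.elim (1 - ∑ i, c i) c)
      (z := fun o => o.elim 0 w) ?_ ?_ ?_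
    · simpa [Fintype.sum_option] using h
    · rintro (_ | i) -
      · simpa using hc1
      · exact hc0 i
    · simp [Fintype.sum_option]
    · rintro (_ | i) -
      · exact subset_convexHull ℝ N h0
      · exact subset_convexHull ℝ N (hw i)

theorem IsCompact.isCompact_convexHull_of_zero_mem {E : Type*} [NormedAddCommGroup E]
    [NormedSpace ℝ E] [FiniteDimensional ℝ E] {N : Set E} (hN : IsCompact N) (h0 : (0 : E) ∈ N) :
    IsCompact (convexHull ℝ N) := by
  have hC : IsCompact {c : Fin (finrank ℝ E) → ℝ | (∀ i, 0 ≤ c i) ∧ ∑ i, c i ≤ 1} := by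
    refine (isCompact_univ_pi fun _ => isCompact_Icc (a := (0 : ℝ)) (b := 1)).of_isClosed_subset
      ?_ ?_
    · simp only [ofPred_and, ofPred_forall]
      exact (isClosed_iInter fun i => isClosed_le continuous_const (continuous_apply i)).inter
        (isClosed_le (by fun_prop) continuous_const)
    · exact fun c hc i _ => ⟨hc.1 i,
        (Finset.single_le_sum (fun j _ => hc.1 j) (Finset.mem_univ i)).trans hc.2⟩
  have h := (hC.prod (isCompact_univ_pi fun _ : Fin (finrank ℝ E) => hN)).image
    (f := fun q => ∑ i, q.1 i • q.2 i) (by fun_prop)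
  convert h using 1
  ext x
  rw [mem_convexHull_iff_exists_fin_finrank h0]
  simp [and_assoc]

/-- Every convex body contains an interior point `p` (the barycentre of a simplex of maximal volume)
with respect to which the body is contained in `-d` times itself. -/
theorem Convex.exists_mem_interior_sub_smul_sub_mem {E : Type*} [NormedAddCommGroup E]
    [NormedSpace ℝ E] [FiniteDimensional ℝ E] (hd : 0 < finrank ℝ E) {K : Set E}
    (hKconv : Convex ℝ K) (hK : IsCompact K) (hKint : (interior K).Nonempty) :
    ∃ p ∈ interior K, ∀ x ∈ K, p - (finrank ℝ E : ℝ)⁻¹ • (x - p) ∈ K := by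
  obtain ⟨q, hq⟩ := hKint
  have hspan : Submodule.span ℝ (K ×ˢ ({1} : Set ℝ)) = ⊤ := by
    set S := Submodule.span ℝ (K ×ˢ ({1} : Set ℝ))
    have hmem : ∀ y ∈ K, (y, (1 : ℝ)) ∈ S := fun y hy => Submodule.subset_span ⟨hy, rfl⟩
    have hzero : ∀ x : E, (x, (0 : ℝ)) ∈ S := fun x => by
      have hev : ∀ᶠ ε in nhdsWithin (0 : ℝ) (Ioi 0), q + ε • x ∈ K := by
        have hcont : Filter.Tendsto (fun ε : ℝ => q + ε • x) (nhds 0) (nhds q) := by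
          have : Continuous fun ε : ℝ => q + ε • x := by fun_prop
          simpa using this.tendsto 0
        exact (hcont.mono_left nhdsWithin_le_nhds).eventually (mem_interior_iff_mem_nhds.mp hq)
      obtain ⟨ε, hε, hε0⟩ := (hev.and self_mem_nhdsWithin).exists
      have hε0' : ε ≠ 0 := (show (0 : ℝ) < ε from hε0).ne'
      have h := S.smul_mem ε⁻¹ (S.sub_mem (hmem _ hε) (hmem _ (interior_subset hq)))
      simpa [smul_smul, hε0'] using h
    refine eq_top_iff.mpr fun ⟨x, t⟩ _ => ?_
    have h := S.add_mem (hzero (x - t • q)) (S.smul_mem t (hmem _ (interior_subset hq)))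
    simpa using h
  obtain ⟨b, hbN, hb⟩ := (hK.prod isCompact_singleton).exists_basis_abs_repr_le_one hspan
  have hcard : (Fintype.card (Fin (finrank ℝ (E × ℝ))) : ℝ) = finrank ℝ E + 1 := by
    simp
  set d : ℝ := (finrank ℝ E : ℝ)
  have hd0 : 0 < d := Nat.cast_pos.mpr hd
  set p : E := (d + 1)⁻¹ • ∑ i, (b i).1 with hp
  have hreflect : ∀ x ∈ K, p - d⁻¹ • (x - p) ∈ K := by
    intro x hx
    set t := b.repr (x, 1)
    have hrepr : ∑ i, t i • b i = (x, (1 : ℝ)) := b.sum_repr _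
    have hfst : ∑ i, t i • (b i).1 = x := by simpa [Prod.fst_sum] using congrArg Prod.fst hrepr
    have hsnd : ∑ i, t i = 1 := by
      have h := congrArg Prod.snd hrepr
      simp only [Prod.snd_sum, Prod.smul_snd] at h
      rw [← h]
      exact Finset.sum_congr rfl fun i _ => by rw [show (b i).2 = 1 from (hbN i).2]; simp
    have key : p - d⁻¹ • (x - p) = ∑ i, (d⁻¹ * (1 - t i)) • (b i).1 := by
      simp only [mul_smul, sub_smul, one_smul, ← Finset.smul_sum, Finset.sum_sub_distrib, hfst]
      have : ∑ i, (b i).1 = (d + 1) • p := by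
        rw [hp, smul_smul, mul_inv_cancel₀ (by positivity), one_smul]
      rw [this]
      match_scalars
      · field_simp
        ring
      · field_simp
    rw [key]
    refine hKconv.sum_mem (fun i _ => ?_) ?_ fun i _ => (hbN i).1
    · have := (abs_le.mp (hb (x, 1) ⟨hx, rfl⟩ i)).2
      exact mul_nonneg (by positivity) (by linarith)
    · rw [← Finset.mul_sum, Finset.sum_sub_distrib, hsnd]
      simp only [Finset.sum_const, nsmul_eq_mul, Finset.card_univ, hcard]
      field_simp
      ring
  refine ⟨p, ?_, hreflect⟩
  refine hKconv.openSegment_interior_self_subset_interior hq (hreflect q (interior_subset hq))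
    ⟨(d + 1)⁻¹, d * (d + 1)⁻¹, by positivity, by positivity, by field_simp; ring, ?_⟩
  match_scalars <;> field_simp <;> ring

section Polar

variable {E : Type*} [NormedAddCommGroup E] [InnerProductSpace ℝ E] [FiniteDimensional ℝ E]

theorem Convex.mem_of_forall_inner_le_one {A : Set E} (hA : Convex ℝ A) (hAc : IsClosed A)
    (h0 : (0 : E) ∈ A) {z : E}
    (hz : ∀ a : E, (∀ x ∈ A, inner ℝ a x ≤ 1) → inner ℝ a z ≤ 1) : z ∈ A := by
  by_contra hzA
  obtain ⟨f, u, hfA, hfz⟩ := geometric_hahn_banach_closed_point hA hAc hzA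
  have hu : 0 < u := by simpa using hfA 0 h0
  have h := hz ((InnerProductSpace.toDual ℝ E).symm (u⁻¹ • f)) fun x hx => by
    rw [InnerProductSpace.toDual_symm_apply]
    simpa [inv_mul_le_iff₀ hu] using (hfA x hx).le
  rw [InnerProductSpace.toDual_symm_apply] at h
  simp only [smul_apply, smul_eq_mul, inv_mul_le_iff₀ hu, mul_one] at h
  linarith

/-- If the intersection `K` of finitely many closed convex sets is a convex body
contained in `-l K`, then at most `2d` of the sets suffice to be contained in `-(l + 2)d K`. -/
theorem exists_card_le_iInter_subset_neg_smul {ι : Type*} [Finite ι] [Nonempty ι] {A : ι → Set E}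
    (hconv : ∀ i, Convex ℝ (A i)) (hclosed : ∀ i, IsClosed (A i))
    (h0 : (0 : E) ∈ interior (⋂ i, A i)) (hbdd : Bornology.IsBounded (⋂ i, A i))
    (hd : 0 < finrank ℝ E) {l : ℝ} (hl : 0 < l)
    (hrefl : ∀ x ∈ ⋂ i, A i, -(l⁻¹ • x) ∈ ⋂ i, A i) :
    ∃ I : Finset ι, I.card ≤ 2 * finrank ℝ E ∧
      ∀ x ∈ ⋂ i ∈ I, A i, -(((l + 2) * finrank ℝ E)⁻¹ • x) ∈ ⋂ i, A i := by
  classical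
  set K := ⋂ i, A i with hK
  have h0A : ∀ i, (0 : E) ∈ A i := mem_iInter.mp (interior_subset h0)
  set P : ι → Set E := fun i => {a | ∀ x ∈ A i, inner ℝ a x ≤ 1} with hP
  set N : Set E := ⋃ i, P i with hN
  have hAmem : ∀ i z, (∀ a ∈ N, inner ℝ a z ≤ 1) → z ∈ A i := fun i z hz =>
    (hconv i).mem_of_forall_inner_le_one (hclosed i) (h0A i) fun a ha =>
      hz a (mem_iUnion.mpr ⟨i, ha⟩)
  have hNK : ∀ a ∈ N, ∀ x ∈ K, inner ℝ a x ≤ 1 := fun a ha x hx => by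
    obtain ⟨i, hi⟩ := mem_iUnion.mp ha
    exact hi x (mem_iInter.mp hx i)
  have h0N : (0 : E) ∈ N := mem_iUnion.mpr ⟨Classical.arbitrary ι, fun x _ => by simp⟩
  have hNcomp : IsCompact N := by
    refine isCompact_iUnion fun i => ?_
    refine Metric.isCompact_of_isClosed_isBounded ?_ ?_
    · simp only [hP, ofPred_forall]
      exact isClosed_biInter fun x _ => isClosed_le (by fun_prop) continuous_const
    · obtain ⟨r, hr, hball⟩ := Metric.nhds_basis_closedBall.mem_iff.mp
        (mem_interior_iff_mem_nhds.mp h0)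
      refine isBounded_iff_forall_norm_le.mpr ⟨r⁻¹, fun a ha => ?_⟩
      rcases eq_or_ne a 0 with rfl | ha0
      · simpa using hr.le
      have hna : 0 < ‖a‖ := norm_pos_iff.mpr ha0
      have hmem : (r * ‖a‖⁻¹) • a ∈ A i := by
        refine mem_iInter.mp (hball ?_) i
        rw [mem_closedBall_zero_iff, norm_smul, norm_mul, norm_inv, norm_norm,
          Real.norm_of_nonneg hr.le]
        field_simp
        exact le_rfl
      have h := ha _ hmem
      rw [inner_smul_right, real_inner_self_eq_norm_sq] at h
      rw [← one_div, le_div_iff₀ hr]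
      calc ‖a‖ * r = r * ‖a‖⁻¹ * ‖a‖ ^ 2 := by field_simp
        _ ≤ 1 := h
  have hspan : Submodule.span ℝ N = ⊤ := by
    rw [← Submodule.orthogonal_eq_bot_iff, Submodule.eq_bot_iff]
    intro x hx
    have hort : ∀ a ∈ N, inner ℝ a x = 0 := fun a ha =>
      (Submodule.mem_orthogonal _ _).mp hx a (Submodule.subset_span ha)
    obtain ⟨R, hR⟩ := isBounded_iff_forall_norm_le.mp hbdd
    by_contra hx0
    have hnx : 0 < ‖x‖ := norm_pos_iff.mpr hx0
    have h := hR (((|R| + 1) * ‖x‖⁻¹) • x) (mem_iInter.mpr fun i => hAmem i _ fun a ha => by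
      simp [inner_smul_right, hort a ha])
    rw [norm_smul, norm_mul, norm_inv, norm_norm, Real.norm_of_nonneg (by positivity), mul_assoc,
      inv_mul_cancel₀ hnx.ne'] at h
    linarith [le_abs_self R]
  obtain ⟨v, hvN, hv⟩ := hNcomp.exists_basis_abs_repr_le_one hspan
  set d : ℝ := (finrank ℝ E : ℝ)
  have hd0 : 0 < d := Nat.cast_pos.mpr hd
  set u : E := d⁻¹ • ∑ i, v i with hu
  have huK : ∀ x ∈ K, inner ℝ x u ≥ -l := by
    intro x hx
    have h : ∀ i, inner ℝ (v i) (-(l⁻¹ • x)) ≤ 1 := fun i => hNK _ (hvN i) _ (hrefl x hx)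
    have h' : ∀ i, -l ≤ inner ℝ x (v i) := fun i => by
      have := h i
      rw [inner_neg_right, inner_smul_right, real_inner_comm, neg_le, ← div_eq_inv_mul,
        le_div_iff₀ hl] at this
      linarith
    rw [hu, inner_smul_right, inner_sum, ge_iff_le, ← div_eq_inv_mul, le_div_iff₀ hd0]
    have := Finset.sum_le_sum fun i (_ : i ∈ Finset.univ) => h' i
    simp only [Finset.sum_const, Finset.card_univ, Fintype.card_fin, nsmul_eq_mul] at this
    linarith
  have huQ : -(l⁻¹ • u) ∈ convexHull ℝ N := by
    refine (convex_convexHull ℝ N).mem_of_forall_inner_le_one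
      (hNcomp.isCompact_convexHull_of_zero_mem h0N).isClosed (subset_convexHull ℝ N h0N)
      fun x hx => ?_
    have hxK : x ∈ K := mem_iInter.mpr fun i => hAmem i x fun a ha => by
      rw [real_inner_comm]
      exact hx a (subset_convexHull ℝ N ha)
    rw [inner_neg_right, inner_smul_right, neg_le, ← div_eq_inv_mul, le_div_iff₀ hl]
    linarith [huK x hxK]
  obtain ⟨c, w, hc0, hc1, hwN, hcw⟩ := (mem_convexHull_iff_exists_fin_finrank h0N).mp huQ
  choose f hf using fun i => mem_iUnion.mp (hvN i)
  choose g hg using fun i => mem_iUnion.mp (hwN i)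
  refine ⟨Finset.univ.image f ∪ Finset.univ.image g, ?_, fun x hx => ?_⟩
  · calc _ ≤ _ := Finset.card_union_le _ _
      _ ≤ _ := Nat.add_le_add Finset.card_image_le Finset.card_image_le
      _ = _ := by simp [two_mul]
  have hxA : ∀ i ∈ Finset.univ.image f ∪ Finset.univ.image g, x ∈ A i := by simpa using hx
  have hvx : ∀ i, inner ℝ (v i) x ≤ 1 := fun i => hf i x (hxA _ (by simp))
  have hwx : ∀ i, inner ℝ (w i) x ≤ 1 := fun i => hg i x (hxA _ (by simp))
  refine mem_iInter.mpr fun i => hAmem i _ fun a ha => ?_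
  have hsumv : -(∑ i, inner ℝ (v i) x) ≤ d * l := by
    have h1 : ∑ i, c i * inner ℝ (w i) x ≤ 1 :=
      (Finset.sum_le_sum fun i _ => mul_le_of_le_one_right (hc0 i) (hwx i)).trans hc1
    have h2 : ∑ i, c i * inner ℝ (w i) x = -(l⁻¹ * (d⁻¹ * ∑ i, inner ℝ (v i) x)) := by
      have := congrArg (fun y => inner ℝ y x) hcw
      simpa [sum_inner, inner_smul_left, hu] using this
    rw [h2] at h1
    have h3 : -(∑ i, inner ℝ (v i) x) =
        d * l * -(l⁻¹ * (d⁻¹ * ∑ i, inner ℝ (v i) x)) := by field_simp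
    rw [h3]
    exact mul_le_of_le_one_right (by positivity) h1
  have hsum : ∑ i, (1 - v.repr a i) * inner ℝ (v i) x ≤ 2 * d := by
    have h1 : ∀ i, (1 - v.repr a i) * inner ℝ (v i) x ≤ 2 := fun i => by
      obtain ⟨h1, h2⟩ := abs_le.mp (hv a ha i)
      nlinarith [hvx i]
    have := Finset.sum_le_sum fun i (_ : i ∈ Finset.univ) => h1 i
    simp only [Finset.sum_const, Finset.card_univ, Fintype.card_fin, nsmul_eq_mul] at this
    linarith
  have hax : inner ℝ a x = ∑ i, v.repr a i * inner ℝ (v i) x := by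
    conv_lhs => rw [← v.sum_repr a, sum_inner]
    simp [inner_smul_left]
  simp only [sub_mul, one_mul, Finset.sum_sub_distrib, ← hax] at hsum
  rw [inner_neg_right, inner_smul_right, neg_le, ← div_eq_inv_mul, le_div_iff₀ (by positivity)]
  linarith

end Polar

section Volume

variable {E : Type*} [NormedAddCommGroup E] [MeasurableSpace E] [BorelSpace E]

theorem Convex.interior_nonempty_of_addHaar_ne_zero [NormedSpace ℝ E] [FiniteDimensional ℝ E]
    (μ : Measure E) [μ.IsAddHaarMeasure] {s : Set E} (hs : Convex ℝ s) (hμ : μ s ≠ 0) :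
    (interior s).Nonempty := by
  by_contra h
  refine hμ (measure_mono_null ?_ (hs.addHaar_frontier μ))
  rw [frontier, not_nonempty_iff_eq_empty.mp h, sdiff_empty]
  exact subset_closure

/-- A quantitative Helly theorem for compact convex sets. -/
theorem le_addHaar_iInter_of_isCompact [InnerProductSpace ℝ E] [FiniteDimensional ℝ E]
    (μ : Measure E) [μ.IsAddHaarMeasure] (hd : 0 < finrank ℝ E) {ι : Type*} [Finite ι] [Nonempty ι]
    {A : ι → Set E} (hconv : ∀ i, Convex ℝ (A i)) (hcomp : ∀ i, IsCompact (A i)) {V : ENNReal}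
    (hV : V ≠ 0) (hA : ∀ I : Finset ι, I.card ≤ 2 * finrank ℝ E → V ≤ μ (⋂ i ∈ I, A i)) :
    V ≤ ENNReal.ofReal ((((finrank ℝ E : ℝ) + 2) * finrank ℝ E) ^ finrank ℝ E) *
      μ (⋂ i, A i) := by
  cases nonempty_fintype ι
  have hd0 : (0 : ℝ) < finrank ℝ E := Nat.cast_pos.mpr hd
  have hKint : (interior (⋂ i, A i)).Nonempty := by
    rw [interior_iInter_of_finite]
    have h := Convex.helly_theorem' (𝕜 := ℝ) (F := fun i => interior (A i)) (s := Finset.univ)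
      (fun i _ => (hconv i).interior) fun I _ hI => by
        have hne := (convex_iInter₂ fun i (_ : i ∈ I) => hconv i).interior_nonempty_of_addHaar_ne_zero
          μ (pos_iff_ne_zero.mp ((pos_iff_ne_zero.mpr hV).trans_le (hA I (by lia))))
        exact hne.mono (subset_iInter₂ fun i hi => interior_mono (biInter_subset_of_mem hi))
    simpa using h
  have hKcomp : IsCompact (⋂ i, A i) :=
    (hcomp (Classical.arbitrary ι)).of_isClosed_subset
      (isClosed_iInter fun i => (hcomp i).isClosed) (iInter_subset _ _)
  obtain ⟨p, hp, hrefl⟩ :=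
    (convex_iInter hconv).exists_mem_interior_sub_smul_sub_mem hd hKcomp hKint
  set B : ι → Set E := fun i => (p + ·) ⁻¹' A i with hB
  have hBinter : ⋂ i, B i = (p + ·) ⁻¹' ⋂ i, A i := by simp [hB, preimage_iInter]
  obtain ⟨I, hI, hsub⟩ := exists_card_le_iInter_subset_neg_smul (A := B) (l := finrank ℝ E)
    (fun i => (hconv i).translate_preimage_right p)
    (fun i => (hcomp i).isClosed.preimage (by fun_prop))
    (by
      rw [hBinter]
      exact preimage_interior_subset_interior_preimage (by fun_prop) (by simpa using hp))
    (by
      rw [hBinter]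
      exact ((Homeomorph.addLeft p).isCompact_preimage.mpr hKcomp).isBounded)
    hd hd0
    (fun x hx => by
      rw [hBinter] at hx ⊢
      simpa [sub_eq_add_neg] using hrefl _ hx)
  set M : ℝ := ((finrank ℝ E : ℝ) + 2) * finrank ℝ E with hM
  have hM0 : 0 < M := by positivity
  have hMne : -M⁻¹ ≠ 0 := neg_ne_zero.mpr (inv_ne_zero hM0.ne')
  calc V ≤ μ (⋂ i ∈ I, A i) := hA I hI
    _ = μ (⋂ i ∈ I, B i) := by
      rw [← measure_preimage_add μ p]
      simp [hB, preimage_iInter]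
    _ ≤ μ ((fun x => (-M⁻¹) • x) ⁻¹' ⋂ i, B i) := measure_mono fun x hx => by
      simpa only [mem_preimage, neg_smul] using hsub x hx
    _ = _ := by
      rw [Measure.addHaar_preimage_smul μ hMne, hBinter, measure_preimage_add, abs_inv, abs_pow,
        abs_neg, abs_inv, abs_of_pos hM0, inv_pow, inv_inv]

/-- Dropping the compactness assumption costs a factor which can be made arbitrarily close to
one. -/
theorem le_addHaar_iInter_of_convex [InnerProductSpace ℝ E] [FiniteDimensional ℝ E]
    (μ : Measure E) [μ.IsAddHaarMeasure] (hd : 0 < finrank ℝ E) {ι : Type*} [Finite ι] [Nonempty ι]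
    {A : ι → Set E} (hconv : ∀ i, Convex ℝ (A i)) {V W : ENNReal} (hW : W ≠ 0) (hWV : W < V)
    (hA : ∀ I : Finset ι, I.card ≤ 2 * finrank ℝ E → V ≤ μ (⋂ i ∈ I, A i)) :
    W ≤ ENNReal.ofReal ((((finrank ℝ E : ℝ) + 2) * finrank ℝ E) ^ finrank ℝ E) *
      μ (⋂ i, A i) := by
  have htrunc : ∀ᶠ n : ℕ in Filter.atTop, ∀ I : Finset ι, I.card ≤ 2 * finrank ℝ E →
      W ≤ μ ((⋂ i ∈ I, A i) ∩ Metric.closedBall 0 n) := by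
    refine Filter.eventually_all.mpr fun I => Filter.eventually_imp_distrib_left.mpr fun hI => ?_
    have hmono : Monotone fun n : ℕ => (⋂ i ∈ I, A i) ∩ Metric.closedBall (0 : E) n :=
      fun m n hmn => inter_subset_inter_right _
        (Metric.closedBall_subset_closedBall (Nat.cast_le.mpr hmn))
    have h := tendsto_measure_iUnion_atTop (μ := μ) hmono
    rw [← inter_iUnion, Metric.iUnion_closedBall_nat, inter_univ] at h
    exact (h.eventually (lt_mem_nhds (hWV.trans_le (hA I hI)))).mono fun n hn => hn.le
  obtain ⟨n, hn⟩ := htrunc.exists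
  have h := le_addHaar_iInter_of_isCompact μ hd
    (A := fun i => closure (A i) ∩ Metric.closedBall 0 n)
    (fun i => (hconv i).closure.inter (convex_closedBall _ _))
    (fun i => (isCompact_closedBall _ _).inter_left isClosed_closure) hW fun I hI =>
      (hn I hI).trans (measure_mono (subset_iInter₂ fun i hi =>
        inter_subset_inter_left _ ((biInter_subset_of_mem hi).trans subset_closure)))
  refine h.trans (mul_le_mul_right ?_ _)
  calc μ (⋂ i, closure (A i) ∩ Metric.closedBall 0 n)
      ≤ μ ((⋂ i, A i) ∪ ⋃ i, frontier (A i)) := measure_mono fun x hx => by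
        by_cases hxA : x ∈ ⋂ i, A i
        · exact Or.inl hxA
        · obtain ⟨i, hi⟩ := not_forall.mp (mt mem_iInter.mpr hxA)
          exact Or.inr (mem_iUnion.mpr
            ⟨i, (mem_iInter.mp hx i).1, fun hxi => hi (interior_subset hxi)⟩)
    _ ≤ μ (⋂ i, A i) + μ (⋃ i, frontier (A i)) := measure_union_le _ _
    _ = μ (⋂ i, A i) := by
      rw [measure_iUnion_null fun i => (hconv i).addHaar_frontier μ, add_zero]

end Volume

/-- In a one-dimensional space, the intersection of a finite family of convex sets is the
intersection of two of its members. -/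
theorem exists_inter_subset_sInter_of_convex {E : Type*} [AddCommGroup E] [Module ℝ E]
    (φ : E →ₗ[ℝ] ℝ) (hφ : Function.Injective φ) {F : Finset (Set E)} (hF : F.Nonempty)
    (hconv : ∀ A ∈ F, Convex ℝ A) :
    ∃ A ∈ F, ∃ B ∈ F, A ∩ B ⊆ ⋂₀ (F : Set (Set E)) := by
  obtain ⟨A, hA, hAmax⟩ := F.exists_max_image (fun A => upperClosure (φ '' A)) hF
  obtain ⟨B, hB, hBmin⟩ := F.exists_min_image (fun A => lowerClosure (φ '' A)) hF
  refine ⟨A, hA, B, hB, fun x ⟨hxA, hxB⟩ C hC => ?_⟩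
  obtain ⟨_, ⟨y, hy, rfl⟩, hyx⟩ := hAmax C hC (subset_upperClosure (mem_image_of_mem φ hxA))
  obtain ⟨_, ⟨z, hz, rfl⟩, hxz⟩ := hBmin C hC (subset_lowerClosure (mem_image_of_mem φ hxB))
  obtain ⟨w, hw, hwx⟩ := ((hconv C hC).linear_image φ).ordConnected.out (mem_image_of_mem φ hy)
    (mem_image_of_mem φ hz) ⟨hyx, hxz⟩
  rwa [← hφ hwx]

/-- Quantitative Helly theorem (Naszódi, Brazitikos): if every 2d members of a finite family
of convex sets in ℝ^d intersect in volume at least 1, then the whole family intersects in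
volume at least d^(-cd). -/
theorem quantitative_helly :
    ∃ c > (0 : ℝ), ∀ d : ℕ, 0 < d →
      ∀ F : Finset (Set (EuclideanSpace ℝ (Fin d))),
        2 * d ≤ F.card →
        (∀ A ∈ F, Convex ℝ A) →
        (∀ S ⊆ F, S.card = 2 * d →
          1 ≤ volume (⋂₀ (S : Set (Set (EuclideanSpace ℝ (Fin d)))))) →
        ENNReal.ofReal ((d : ℝ) ^ (-(c * (d : ℝ)))) ≤
          volume (⋂₀ (F : Set (Set (EuclideanSpace ℝ (Fin d))))) := by
  classical
  refine ⟨4, by norm_num, fun d hd F hcard hconv hF => ?_⟩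
  have hvol : ∀ S ⊆ F, S.card ≤ 2 * d →
      1 ≤ volume (⋂₀ (S : Set (Set (EuclideanSpace ℝ (Fin d))))) := fun S hS hSc => by
    obtain ⟨T, hST, hTF, hT⟩ := Finset.exists_subsuperset_card_eq hS hSc hcard
    exact (hF T hTF hT).trans (measure_mono (sInter_subset_sInter (Finset.coe_subset.mpr hST)))
  have hne : F.Nonempty := Finset.card_pos.mp (by lia)
  rcases (show d = 1 ∨ 2 ≤ d by lia) with rfl | hd2
  · obtain ⟨A, hA, B, hB, hAB⟩ := exists_inter_subset_sInter_of_convex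
      (EuclideanSpace.proj (0 : Fin 1) : EuclideanSpace ℝ (Fin 1) →L[ℝ] ℝ).toLinearMap
      (fun x y hxy => by
        ext i
        rw [Subsingleton.elim i 0]
        exact hxy) hne hconv
    have h : 1 ≤ volume (⋂₀ (F : Set (Set (EuclideanSpace ℝ (Fin 1))))) :=
      (hvol {A, B} (by simp [Finset.insert_subset_iff, hA, hB]) Finset.card_le_two).trans
        (measure_mono (by
        rw [Finset.coe_pair, sInter_pair]
        exact hAB))
    simpa using h
  · have : Nonempty F := hne.to_subtype
    have h := le_addHaar_iInter_of_convex (volume : Measure (EuclideanSpace ℝ (Fin d)))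
      (by simpa using hd) (A := fun i : F => (i : Set (EuclideanSpace ℝ (Fin d))))
      (fun i => hconv i i.2) (V := 1) (W := 2⁻¹) (by simp) (by simp) fun I hI => by
        have h := hvol (I.map (Function.Embedding.subtype _))
          (fun x hx => by
            obtain ⟨y, -, rfl⟩ := Finset.mem_map.mp hx
            exact y.2) (by simpa using hI)
        refine h.trans (measure_mono (subset_iInter₂ fun i hi => sInter_subset_of_mem ?_))
        exact Finset.mem_coe.mpr (Finset.mem_map_of_mem _ hi)
    have hinter : ⋂ i : F, (i : Set (EuclideanSpace ℝ (Fin d))) =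
        ⋂₀ (F : Set (Set (EuclideanSpace ℝ (Fin d)))) := sInter_eq_iInter.symm
    rw [finrank_euclideanSpace_fin, hinter] at h
    have hd2' : (2 : ℝ) ≤ d := by exact_mod_cast hd2
    set M : ℝ := ((d : ℝ) + 2) * d with hM
    have hreal : (d : ℝ) ^ (-(4 * (d : ℝ))) * (2 * M ^ d) ≤ 1 := by
      have h1 : (d : ℝ) ^ (-(4 * (d : ℝ))) = (((d : ℝ) ^ 4) ^ d)⁻¹ := by
        rw [Real.rpow_neg (by positivity), ← pow_mul, ← Real.rpow_natCast]
        norm_num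
      rw [h1, inv_mul_le_one₀ (by positivity)]
      calc 2 * M ^ d ≤ 2 ^ d * M ^ d := by
            gcongr
            exact le_self_pow₀ one_le_two hd.ne'
        _ = (2 * M) ^ d := (mul_pow _ _ _).symm
        _ ≤ ((d : ℝ) ^ 4) ^ d := by
            gcongr
            have h3 : 2 * ((d : ℝ) + 2) ≤ (d : ℝ) ^ 3 := by nlinarith [sq_nonneg ((d : ℝ) - 2)]
            calc 2 * M = 2 * ((d : ℝ) + 2) * d := by rw [hM]; ring
              _ ≤ (d : ℝ) ^ 3 * d := by gcongr
              _ = (d : ℝ) ^ 4 := by ring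
    calc ENNReal.ofReal ((d : ℝ) ^ (-(4 * (d : ℝ))))
        = ENNReal.ofReal ((d : ℝ) ^ (-(4 * (d : ℝ)))) * 2 * 2⁻¹ := by
          rw [mul_assoc, ENNReal.mul_inv_cancel (by simp) (by simp), mul_one]
      _ ≤ ENNReal.ofReal ((d : ℝ) ^ (-(4 * (d : ℝ)))) * 2 * (ENNReal.ofReal (M ^ d) *
            volume (⋂₀ (F : Set (Set (EuclideanSpace ℝ (Fin d)))))) := by gcongr
      _ = ENNReal.ofReal ((d : ℝ) ^ (-(4 * (d : ℝ))) * (2 * M ^ d)) *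
            volume (⋂₀ (F : Set (Set (EuclideanSpace ℝ (Fin d))))) := by
          rw [ENNReal.ofReal_mul (by positivity), ENNReal.ofReal_mul (by positivity),
            ENNReal.ofReal_ofNat]
          ring
      _ ≤ 1 * volume (⋂₀ (F : Set (Set (EuclideanSpace ℝ (Fin d))))) := by
          gcongr
          simpa using hreal
      _ = _ := one_mul _
end

section
/- Let K ⊂ ℝ^d be a convex body and let E be a largest-volume ellipsoid contained in K. If E is centered at the origin, then K ⊆ d·E, where d·E denotes the dilation of E by factor d about the origin. -/
open MeasureTheory
open scoped Pointwise

/-- Stretching by `a` along `e` and by `b` orthogonally to `e`, for a unit vector `e`. -/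
noncomputable def axialStretch {V : Type*} [NormedAddCommGroup V] [InnerProductSpace ℝ V]
    (a b : ℝ) (e : V) : V →ₗ[ℝ] V :=
  b • LinearMap.transvection (innerₛₗ ℝ e) (((a - b) / b) • e)

section axialStretch

variable {V : Type*} [NormedAddCommGroup V] [InnerProductSpace ℝ V]

lemma axialStretch_apply {a b : ℝ} (hb : b ≠ 0) (e x : V) :
    axialStretch a b e x = b • x + ((a - b) * inner ℝ e x) • e := by
  simp only [axialStretch, LinearMap.smul_apply, LinearMap.transvection.apply, smul_add,
    innerₛₗ_apply_apply, smul_smul]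
  congr 2
  field_simp

lemma det_axialStretch [FiniteDimensional ℝ V] {a b : ℝ} (hb : b ≠ 0) {e : V} (he : ‖e‖ = 1)
    (hV : 0 < Module.finrank ℝ V) :
    LinearMap.det (axialStretch a b e) = a * b ^ (Module.finrank ℝ V - 1) := by
  obtain ⟨n, hn⟩ := Nat.exists_eq_succ_of_ne_zero hV.ne'
  rw [axialStretch, LinearMap.det_smul, LinearMap.transvection.det, hn]
  simp only [innerₛₗ_apply_apply, inner_smul_right, real_inner_self_eq_norm_sq, he,
    Nat.succ_eq_add_one, Nat.add_sub_cancel, pow_succ]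
  field_simp
  ring

lemma inner_axialStretch {a b : ℝ} (hb : b ≠ 0) (e x y : V) :
    inner ℝ x (axialStretch a b e y) = inner ℝ (axialStretch a b e x) y := by
  simp only [axialStretch_apply hb, inner_add_right, inner_add_left, inner_smul_right,
    inner_smul_left, RCLike.conj_to_real]
  rw [real_inner_comm x e]
  ring

lemma norm_axialStretch_sq {a b : ℝ} (hb : b ≠ 0) {e : V} (he : ‖e‖ = 1) (x : V) :
    ‖axialStretch a b e x‖ ^ 2 = b ^ 2 * ‖x‖ ^ 2 + (a ^ 2 - b ^ 2) * inner ℝ e x ^ 2 := by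
  rw [axialStretch_apply hb, norm_add_sq_real, norm_smul, norm_smul, mul_pow, mul_pow, he,
    inner_smul_left, inner_smul_right, real_inner_comm e x]
  simp only [Real.norm_eq_abs, sq_abs, RCLike.conj_to_real]
  ring

end axialStretch

/-- The support function of the stretched ball is bounded by that of the convex hull of the unit
ball and a point at distance `r`. Here `n` is the norm of the direction, `t` its component along
the axis and `s` the norm of the stretched direction. -/
lemma stretched_support_le {r b c n t s : ℝ} (hr : 1 < r) (hb0 : 0 < b) (hb1 : b < 1)
    (hc : 2 * c = (1 - b ^ 2) * (r - 1)) (hn : 0 ≤ n) (ht : |t| ≤ n)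
    (hs : s ^ 2 = b ^ 2 * n ^ 2 + ((1 + c) ^ 2 - b ^ 2) * t ^ 2) :
    c * t + s ≤ max n (r * t) := by
  have hbb : b ^ 2 < 1 := by nlinarith
  have hbp : 0 < b ^ 2 := by positivity
  have hc0 : 0 < c := by nlinarith
  have hcr : 2 * c < r - 1 := by nlinarith
  obtain ⟨ht1, ht2⟩ := abs_le.mp ht
  have hr1 : (r - 1) ≠ 0 := by linarith
  have hb2 : b ^ 2 = 1 - 2 * c / (r - 1) := by field_simp; linarith
  rcases le_total (r * t) n with h | h
  · refine le_max_of_le_left ?_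
    have hk : 0 ≤ n - c * t := by
      rcases le_total t 0 with h0 | h0
      · nlinarith
      · nlinarith
    have key : s ^ 2 ≤ (n - c * t) ^ 2 := by
      have : s ^ 2 - (n - c * t) ^ 2 = (2 * c / (r - 1)) * ((n + t) * (r * t - n)) := by
        rw [hs, hb2]; field_simp; ring
      have h2 : 0 ≤ 2 * c / (r - 1) := div_nonneg (by linarith) (by linarith)
      have h3 : (n + t) * (r * t - n) ≤ 0 :=
        mul_nonpos_of_nonneg_of_nonpos (by linarith) (by linarith)
      nlinarith
    have := abs_le_of_sq_le_sq key hk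
    linarith [le_abs_self s]
  · refine le_max_of_le_right ?_
    have ht0 : 0 ≤ t := by
      by_contra! h0
      nlinarith
    have key : s ^ 2 ≤ ((r - c) * t) ^ 2 := by
      have : s ^ 2 - ((r - c) * t) ^ 2 = b ^ 2 * (n ^ 2 - (r * t) ^ 2) := by
        rw [hs, hb2]; field_simp; ring
      have h3 : n ^ 2 ≤ (r * t) ^ 2 := by gcongr
      nlinarith
    have := abs_le_of_sq_le_sq key (mul_nonneg (by linarith) ht0)
    linarith [le_abs_self s]

lemma exists_stretch_parameter {r : ℝ} {m : ℕ} (hr : (m : ℝ) + 1 < r) :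
    ∃ b : ℝ, 0 < b ∧ b < 1 ∧ 1 < (1 + (1 - b ^ 2) * (r - 1) / 2) * b ^ m := by
  obtain ⟨R, rfl⟩ : ∃ R, r = R + 1 := ⟨r - 1, by ring⟩
  have hm : (0 : ℝ) ≤ m := m.cast_nonneg
  have hR : (m : ℝ) < R := by linarith
  have hR0 : 0 < R := by linarith
  obtain ⟨ε, hε⟩ : ∃ ε, ε = (R - m) / (R * (m + 2)) := ⟨_, rfl⟩
  have hεR : ε * R * (m + 2) = R - m := by rw [hε]; field_simp
  have hε0 : 0 < ε := by rw [hε]; exact div_pos (by linarith) (by positivity)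
  have hε1 : ε * (m + 2) ≤ 1 := by
    rw [hε, div_mul_eq_mul_div, div_le_one (by positivity)]
    nlinarith
  have hεlt : ε < 1 := by nlinarith
  refine ⟨1 - ε, by linarith, by linarith, ?_⟩
  have hbern : 1 - m * ε ≤ (1 - ε) ^ m := by
    have := one_add_mul_le_pow (a := -ε) (by linarith) m
    calc 1 - m * ε = 1 + m * -ε := by ring
      _ ≤ (1 + -ε) ^ m := this
      _ = (1 - ε) ^ m := by ring
  have hA : 0 ≤ 1 + (1 - (1 - ε) ^ 2) * (R + 1 - 1) / 2 := by
    have : 0 ≤ (2 - ε) * ε * R := mul_nonneg (mul_nonneg (by linarith) hε0.le) hR0.le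
    nlinarith
  refine lt_of_lt_of_le ?_ (mul_le_mul_of_nonneg_left hbern hA)
  have h1 : (1 + (1 - (1 - ε) ^ 2) * (R + 1 - 1) / 2) * (1 - m * ε)
      = 1 + ε * ((R - m) - ε * R * (m + 1 / 2) + m * R * ε ^ 2 / 2) := by ring
  have h2 : 0 < (R - m) - ε * R * (m + 1 / 2) + m * R * ε ^ 2 / 2 := by
    rw [← hεR]
    have : 0 < ε * R := by positivity
    have : 0 ≤ m * R * ε ^ 2 / 2 := by positivity
    nlinarith
  rw [h1]
  linarith [mul_pos hε0 h2]

lemma add_axialStretch_mem {V : Type*} [NormedAddCommGroup V] [InnerProductSpace ℝ V]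
    [CompleteSpace V] {K : Set V} (hK : IsClosed K) (hconv : Convex ℝ K)
    (hball : Metric.closedBall 0 1 ⊆ K) {e : V} (he : ‖e‖ = 1) {r b c : ℝ} (hr : 1 < r)
    (hre : r • e ∈ K) (hb0 : 0 < b) (hb1 : b < 1) (hc : 2 * c = (1 - b ^ 2) * (r - 1))
    {y : V} (hy : ‖y‖ ≤ 1) : c • e + axialStretch (1 + c) b e y ∈ K := by
  by_contra hx
  obtain ⟨f, u, hfK, hfx⟩ := geometric_hahn_banach_closed_point hconv hK hx
  obtain ⟨w, rfl⟩ := (InnerProductSpace.toDual ℝ V).surjective f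
  simp only [InnerProductSpace.toDual_apply_apply] at hfK hfx
  have hwe : inner ℝ w (r • e) < u := hfK _ hre
  have hnorm : ‖w‖ < u := by
    have := hfK (‖w‖⁻¹ • w) (hball (by
      rw [mem_closedBall_zero_iff, norm_smul, norm_inv, norm_norm]
      exact inv_mul_le_one))
    rw [inner_smul_right, real_inner_self_eq_norm_sq] at this
    rcases eq_or_ne ‖w‖ 0 with h0 | h0
    · simpa [h0] using this
    · convert this using 1
      field_simp
  rw [inner_add_right, inner_smul_right, inner_axialStretch hb0.ne'] at hfx
  have h1 : inner ℝ (axialStretch (1 + c) b e w) y ≤ ‖axialStretch (1 + c) b e w‖ :=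
    (real_inner_le_norm _ _).trans (mul_le_of_le_one_right (norm_nonneg _) hy)
  have h2 := stretched_support_le hr hb0 hb1 hc (norm_nonneg w)
    (t := inner ℝ e w) (by simpa [he] using abs_real_inner_le_norm e w)
    (norm_axialStretch_sq hb0.ne' he w)
  rw [inner_smul_right] at hwe
  rw [real_inner_comm] at h2
  have h3 := max_lt hnorm hwe
  linarith

/-- A closed convex set containing the unit ball and a point at distance more than the dimension
contains an ellipsoid of volume larger than that of the unit ball. -/
lemma exists_ellipsoid_volume_gt {d : ℕ} (hd : 0 < d) {K : Set (EuclideanSpace ℝ (Fin d))}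
    (hK : IsClosed K) (hconv : Convex ℝ K) (hball : Metric.closedBall 0 1 ⊆ K)
    {q : EuclideanSpace ℝ (Fin d)} (hqK : q ∈ K) (hq : (d : ℝ) < ‖q‖) :
    ∃ B : EuclideanSpace ℝ (Fin d) ≃ᵃ[ℝ] EuclideanSpace ℝ (Fin d),
      B '' Metric.closedBall 0 1 ⊆ K ∧
      volume (Metric.closedBall (0 : EuclideanSpace ℝ (Fin d)) 1)
        < volume (B '' Metric.closedBall 0 1) := by
  obtain ⟨m, rfl⟩ := Nat.exists_eq_succ_of_ne_zero hd.ne'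
  have hr : (m : ℝ) + 1 < ‖q‖ := by exact_mod_cast hq
  have hr1 : 1 < ‖q‖ := by linarith [m.cast_nonneg (α := ℝ)]
  have hq0 : ‖q‖ ≠ 0 := by linarith
  obtain ⟨b, hb0, hb1, hb⟩ := exists_stretch_parameter hr
  set c : ℝ := (1 - b ^ 2) * (‖q‖ - 1) / 2 with hc
  set e : EuclideanSpace ℝ (Fin (m + 1)) := ‖q‖⁻¹ • q with he
  have he1 : ‖e‖ = 1 := by rw [he, norm_smul, norm_inv, norm_norm, inv_mul_cancel₀ hq0]
  have hre : ‖q‖ • e = q := by rw [he, smul_inv_smul₀ hq0]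
  have hdet : LinearMap.det (axialStretch (1 + c) b e) = (1 + c) * b ^ m := by
    rw [det_axialStretch hb0.ne' he1 (by simp)]
    simp
  have hunit : IsUnit (LinearMap.det (axialStretch (1 + c) b e)) := by
    rw [hdet, isUnit_iff_ne_zero]
    linarith
  let T := LinearMap.equivOfDetNeZero (axialStretch (1 + c) b e) hunit.ne_zero
  let B := T.toAffineEquiv.trans (AffineEquiv.constVAdd ℝ _ (c • e))
  have hB : ∀ y, B y = c • e + axialStretch (1 + c) b e y := fun y => rfl
  refine ⟨B, ?_, ?_⟩
  · rintro _ ⟨y, hy, rfl⟩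
    rw [hB]
    exact add_axialStretch_mem hK hconv hball he1 hr1 (by rwa [hre]) hb0 hb1
      (by rw [hc]; ring) (mem_closedBall_zero_iff.mp hy)
  · have himage : B '' Metric.closedBall 0 1
        = (c • e) +ᵥ (axialStretch (1 + c) b e '' Metric.closedBall 0 1) := by
      rw [← Set.image_vadd, Set.image_image]
      rfl
    rw [himage, measure_vadd, Measure.addHaar_image_linearMap, hdet]
    have hpos : volume (Metric.closedBall (0 : EuclideanSpace ℝ (Fin (m + 1))) 1) ≠ 0 :=
      (Metric.measure_closedBall_pos volume _ one_pos).ne'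
    have hfin : volume (Metric.closedBall (0 : EuclideanSpace ℝ (Fin (m + 1))) 1) ≠ ⊤ :=
      measure_closedBall_lt_top.ne
    conv_lhs => rw [← one_mul (volume _)]
    refine ENNReal.mul_lt_mul_left hpos hfin ?_
    rw [← ENNReal.ofReal_one, ENNReal.ofReal_lt_ofReal_iff (by rw [abs_pos]; linarith)]
    exact hb.trans_le (le_abs_self _)

/-- John's theorem: if the largest-volume ellipsoid in a convex body K is centered at the
origin, then K is contained in its dilation by the factor d. -/
theorem john_ellipsoid_dilation (d : ℕ) (hd : 0 < d)
    (K E : Set (EuclideanSpace ℝ (Fin d)))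
    (hK : IsCompact K) (hKconv : Convex ℝ K) (hKint : (interior K).Nonempty)
    (hE : ∃ A : EuclideanSpace ℝ (Fin d) ≃ᵃ[ℝ] EuclideanSpace ℝ (Fin d),
      E = A '' Metric.closedBall 0 1 ∧ A 0 = 0)
    (hEK : E ⊆ K)
    (hmax : ∀ E' : Set (EuclideanSpace ℝ (Fin d)),
      IsEllipsoid E' → E' ⊆ K → volume E' ≤ volume E) :
    K ⊆ (d : ℝ) • E := by
  obtain ⟨A, rfl, hA0⟩ := hE
  have hA : ∀ x, A x = A.linear x := fun x => by
    have := A.map_vadd 0 x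
    simpa [hA0] using this
  have hvol : ∀ s : Set (EuclideanSpace ℝ (Fin d)), volume (A '' s)
      = ENNReal.ofReal |LinearMap.det (A.linear : _ →ₗ[ℝ] EuclideanSpace ℝ (Fin d))|
        * volume s := fun s => by
    rw [← Measure.addHaar_image_linearMap]
    exact congrArg volume (Set.image_congr fun x _ => hA x)
  intro p hp
  have hd0 : (0 : ℝ) < d := by exact_mod_cast hd
  by_cases hq : ‖A.symm p‖ ≤ d
  · refine ⟨A ((d : ℝ)⁻¹ • A.symm p), ⟨_, ?_, rfl⟩, ?_⟩
    · rw [mem_closedBall_zero_iff, norm_smul, norm_inv, Real.norm_natCast,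
        inv_mul_le_one₀ hd0]
      exact hq
    · change (d : ℝ) • A ((d : ℝ)⁻¹ • A.symm p) = p
      rw [hA, map_smul, smul_inv_smul₀ hd0.ne', ← hA, A.apply_symm_apply]
  · exfalso
    have hcont : Continuous A := A.toAffineMap.continuous_of_finiteDimensional
    obtain ⟨B, hBK, hBvol⟩ := exists_ellipsoid_volume_gt hd (K := A ⁻¹' K)
      (hK.isClosed.preimage hcont) (hKconv.affine_preimage A.toAffineMap)
      (Set.image_subset_iff.mp hEK) (q := A.symm p) (by simpa using hp) (not_le.mp hq)
    have hle := hmax (A '' (B '' Metric.closedBall 0 1))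
      ⟨B.trans A, by rw [Set.image_image]; rfl⟩ (Set.image_subset_iff.mpr hBK)
    rw [hvol, hvol] at hle
    have hdet : LinearMap.det (A.linear : _ →ₗ[ℝ] EuclideanSpace ℝ (Fin d)) ≠ 0 :=
      A.linear.isUnit_det'.ne_zero
    exact hle.not_gt (ENNReal.mul_lt_mul_right
      (ENNReal.ofReal_pos.mpr (abs_pos.mpr hdet)).ne' ENNReal.ofReal_ne_top hBvol)
end

section
/- (h-partite Ramsey theorem) Given positive integers h, m, q, there exists a positive integer M = M(h,m,q) such that the following holds. For every coloring of the edges of the complete h-partite h-uniform hypergraph L_h(M) with q colors, there exist a color and subsets of size m of each of the h vertex classes such that every edge spanned by choosing one vertex from each of these subsets receives that color. -/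
/-- The multipartite Ramsey theorem without the positivity assumptions on the number and the
size of the classes. -/
theorem exists_monochromatic_box (h m q : ℕ) (hq : 0 < q) :
    ∃ M : ℕ, 0 < M ∧
      ∀ χ : (Fin h → Fin M) → Fin q,
        ∃ (c : Fin q) (V : Fin h → Finset (Fin M)),
          (∀ i, (V i).card = m) ∧
          ∀ f : Fin h → Fin M, (∀ i, f i ∈ V i) → χ f = c := by
  classical
  induction h with
  | zero =>
    exact ⟨1, one_pos, fun χ => ⟨χ Fin.elim0, fun _ => ∅, fun i => i.elim0,
      fun f _ => congrArg χ (Subsingleton.elim _ _)⟩⟩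
  | succ h ih =>
    obtain ⟨N, hN, ih⟩ := ih
    have : Nonempty (Fin q) := ⟨⟨0, hq⟩⟩
    let B := (Fin h → Fin N) → Fin q
    refine ⟨Fintype.card B * m + N, by omega, fun χ => ?_⟩
    let e : Fin N ↪ Fin (Fintype.card B * m + N) := (Fin.natAddEmb (Fintype.card B * m))
    let F : Fin (Fintype.card B * m + N) → B := fun x g => χ (Fin.cons x (fun i => e (g i)))
    obtain ⟨b, hb⟩ := Fintype.exists_le_card_fiber_of_mul_le_card F (n := m) (by simp)
    obtain ⟨S, hS, hSm⟩ := Finset.exists_subset_card_eq hb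
    obtain ⟨c, V, hV, hc⟩ := ih b
    refine ⟨c, Fin.cons S (fun i => (V i).map e), ?_, fun f hf => ?_⟩
    · intro i
      refine Fin.cases ?_ (fun i => ?_) i
      · simpa using hSm
      · simpa using hV i
    · have h0 : f 0 ∈ S := by simpa using hf 0
      have hs : ∀ i : Fin h, ∃ y ∈ V i, e y = f i.succ := fun i => by
        simpa only [Fin.cons_succ, Finset.mem_map] using hf i.succ
      choose g hg hgf using hs
      have hF : F (f 0) = b := by simpa using hS h0
      have hfg : (Fin.cons (f 0) (fun i => e (g i)) : Fin (h + 1) → _) = f := by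
        simp only [hgf]
        exact Fin.cons_self_tail f
      rw [← hc g hg, ← hF]
      exact congrArg χ hfg.symm


/-- h-partite Ramsey theorem: every q-coloring of the edges of the complete h-partite
h-uniform hypergraph with classes of size M (edges identified with functions Fin h → Fin M)
contains a monochromatic complete h-partite subhypergraph with classes of size m. -/
theorem multipartite_ramsey (h m q : ℕ) (hh : 0 < h) (hm : 0 < m) (hq : 0 < q) :
    ∃ M : ℕ, 0 < M ∧
      ∀ χ : (Fin h → Fin M) → Fin q,
        ∃ (c : Fin q) (V : Fin h → Finset (Fin M)),
          (∀ i, (V i).card = m) ∧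
          ∀ f : Fin h → Fin M, (∀ i, f i ∈ V i) → χ f = c := by
  exact exists_monochromatic_box h m q hq
end

section
/- (Hypergraph supersaturation) Let h and m be positive integers. For every α > 0 there exist γ = γ(h,m,α) > 0 and a positive integer n0 such that for every n ≥ n0 the following holds. If H is an h-uniform hypergraph on n vertices with at least α·(n choose h) edges, then H contains at least γ·n^(h·m) copies of L_h(m), i.e., at least γ·n^(h·m) ways to choose h pairwise disjoint m-element vertex subsets V_1, …, V_h (with vertices labeled) such that every h-element set containing exactly one vertex from each V_i is an edge of H. -/
/-- Power mean inequality: if `a` has average at least `δ`, then `a ^ M` has average at least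
`δ ^ M`. -/
theorem pow_mul_card_le_sum_pow {ι : Type*} [Fintype ι] (a : ι → ℝ) (ha : ∀ i, 0 ≤ a i)
    {δ : ℝ} (hδ : 0 ≤ δ) (h : δ * Fintype.card ι ≤ ∑ i, a i) (M : ℕ) :
    δ ^ M * Fintype.card ι ≤ ∑ i, a i ^ M := by
  rcases isEmpty_or_nonempty ι with hι | hι
  · simp
  have hN : (0 : ℝ) < Fintype.card ι := by exact_mod_cast Fintype.card_pos
  have key := Real.pow_arith_mean_le_arith_mean_pow Finset.univ
    (fun _ : ι => (Fintype.card ι : ℝ)⁻¹) a (fun _ _ => by positivity) (by simp)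
    (fun i _ => ha i) M
  rw [← Finset.mul_sum, ← Finset.mul_sum] at key
  have h1 : δ ≤ (Fintype.card ι : ℝ)⁻¹ * ∑ i, a i := by
    rw [inv_mul_eq_div, le_div_iff₀ hN]
    exact h
  have h2 := (pow_le_pow_left₀ hδ h1 M).trans key
  rwa [inv_mul_eq_div, le_div_iff₀ hN] at h2

/-- A nonnegative weight on `k`-tuples with average at least `δ` has homomorphism density of the
complete `k`-partite `k`-uniform hypergraph with classes of size `m` at least `δ ^ (m ^ k)`. -/
theorem pow_mul_pow_card_le_sum_prod {V : Type*} [Fintype V] [Nonempty V] (m k : ℕ)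
    (w : (Fin k → V) → ℝ) (hw : ∀ x, 0 ≤ w x) {δ : ℝ} (hδ : 0 ≤ δ)
    (h : δ * (Fintype.card V : ℝ) ^ k ≤ ∑ x, w x) :
    δ ^ (m ^ k) * (Fintype.card V : ℝ) ^ (k * m) ≤
      ∑ f : Fin k → Fin m → V, ∏ g : Fin k → Fin m, w (fun i => f i (g i)) := by
  induction k generalizing δ with
  | zero => simpa [Subsingleton.elim _ (default : Fin 0 → V)] using h
  | succ k ih =>
    have hN : (0 : ℝ) < Fintype.card V := by exact_mod_cast Fintype.card_pos
    set N : ℝ := (Fintype.card V : ℝ) with hNdef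
    have hsplit : ∑ x, w x = ∑ x' : Fin k → V, ∑ x₀ : V, w (Fin.cons x₀ x') := by
      rw [← (Fin.consEquiv fun _ => V).sum_comp, Fintype.sum_prod_type, Finset.sum_comm]
      rfl
    have hlink := pow_mul_card_le_sum_pow (fun x' : Fin k → V => ∑ x₀ : V, w (Fin.cons x₀ x'))
      (fun _ => Finset.sum_nonneg fun _ _ => hw _) (mul_nonneg hδ hN.le)
      (by
        rw [← hsplit, Fintype.card_fun, Fintype.card_fin, Nat.cast_pow, ← hNdef]
        calc δ * N * N ^ k = δ * N ^ (k + 1) := by ring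
          _ ≤ _ := h) m
    have hswap : ∑ x' : Fin k → V, (∑ x₀ : V, w (Fin.cons x₀ x')) ^ m =
        ∑ y : Fin m → V, ∑ x' : Fin k → V, ∏ j, w (Fin.cons (y j) x') := by
      simp_rw [Fintype.sum_pow]
      exact Finset.sum_comm
    rw [hswap, Fintype.card_fun, Fintype.card_fin, Nat.cast_pow, ← hNdef] at hlink
    have hmean := pow_mul_card_le_sum_pow
      (fun y : Fin m → V => (∑ x' : Fin k → V, ∏ j, w (Fin.cons (y j) x')) / N ^ k)
      (fun _ => div_nonneg (Finset.sum_nonneg fun _ _ => Finset.prod_nonneg fun _ _ => hw _)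
        (by positivity)) (pow_nonneg hδ m)
      (by
        rw [← Finset.sum_div, le_div_iff₀ (by positivity), Fintype.card_fun, Fintype.card_fin,
          Nat.cast_pow, ← hNdef, ← mul_pow]
        exact hlink) (m ^ k)
    rw [Fintype.card_fun, Fintype.card_fin, Nat.cast_pow, ← hNdef, ← pow_mul, ← pow_succ'] at hmean
    have hfib (y : Fin m → V) := ih (fun x' => ∏ j, w (Fin.cons (y j) x'))
      (fun _ => Finset.prod_nonneg fun _ _ => hw _)
      (δ := (∑ x' : Fin k → V, ∏ j, w (Fin.cons (y j) x')) / N ^ k)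
      (div_nonneg (Finset.sum_nonneg fun _ _ => Finset.prod_nonneg fun _ _ => hw _)
        (by positivity)) (by rw [div_mul_cancel₀ _ (by positivity)])
    have htotal : ∑ f : Fin (k + 1) → Fin m → V, ∏ g : Fin (k + 1) → Fin m,
          w (fun i => f i (g i)) =
        ∑ y : Fin m → V, ∑ f : Fin k → Fin m → V, ∏ g : Fin k → Fin m, ∏ j,
          w (Fin.cons (y j) fun i => f i (g i)) := by
      rw [← (Fin.consEquiv fun _ => Fin m → V).sum_comp, Fintype.sum_prod_type]
      refine Finset.sum_congr rfl fun y _ => Finset.sum_congr rfl fun f _ => ?_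
      rw [← (Fin.consEquiv fun _ => Fin m).prod_comp, Fintype.prod_prod_type, Finset.prod_comm]
      refine Finset.prod_congr rfl fun g _ => Finset.prod_congr rfl fun j _ => congrArg w ?_
      ext i
      refine Fin.cases ?_ (fun i => ?_) i <;> simp [Fin.consEquiv]
    rw [htotal]
    calc δ ^ m ^ (k + 1) * N ^ ((k + 1) * m)
        = δ ^ m ^ (k + 1) * N ^ m * N ^ (k * m) := by ring
      _ ≤ _ := mul_le_mul_of_nonneg_right hmean (by positivity)
      _ ≤ _ := by
        rw [Finset.sum_mul]
        exact Finset.sum_le_sum fun y _ => hfib y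

open scoped Classical in
/-- At most a `1 / |V|` fraction of all maps `ι → V` identify two given points. -/
theorem card_filter_apply_eq_mul_card_le {ι V : Type*} [Fintype ι] [Fintype V] {a b : ι}
    (hab : a ≠ b) :
    (Finset.univ.filter fun f : ι → V => f a = f b).card * Fintype.card V ≤
      Fintype.card V ^ Fintype.card ι := by
  rw [← Fintype.card_fun, ← Finset.card_univ (α := V), ← Finset.card_product,
    ← Finset.card_univ (α := ι → V)]
  refine Finset.card_le_card_of_injOn (fun p => Function.update p.1 a p.2)
    (fun _ _ => Finset.mem_coe.2 (Finset.mem_univ _)) ?_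
  rintro ⟨f, v⟩ hf ⟨f', v'⟩ hf' heq
  simp only [Finset.coe_product, Set.mem_prod, Finset.mem_coe, Finset.mem_filter,
    Finset.mem_univ, true_and, and_true] at hf hf'
  have hne (c : ι) (hc : c ≠ a) : f c = f' c := by
    simpa [hc] using congrFun heq c
  have hv : v = v' := by simpa using congrFun heq a
  refine Prod.ext (funext fun c => ?_) hv
  by_cases hc : c = a
  · subst hc
    exact hf.trans ((hne b hab.symm).trans hf'.symm)
  · exact hne c hc

open scoped Classical in
theorem card_filter_not_injective_mul_card_le (ι V : Type*) [Fintype ι] [Fintype V]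
    [DecidablePred fun f : ι → V => ¬ Function.Injective f] :
    (Finset.univ.filter fun f : ι → V => ¬ Function.Injective f).card * Fintype.card V ≤
      Fintype.card ι ^ 2 * Fintype.card V ^ Fintype.card ι := by
  have hsub : (Finset.univ.filter fun f : ι → V => ¬ Function.Injective f) ⊆
      (Finset.univ.filter fun p : ι × ι => p.1 ≠ p.2).biUnion
        fun p => Finset.univ.filter fun f : ι → V => f p.1 = f p.2 := by
    intro f hf
    obtain ⟨a, b, hfab, hab⟩ := Function.not_injective_iff.1 (Finset.mem_filter.1 hf).2
    simpa using ⟨a, b, hab, hfab⟩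
  calc _ ≤ (∑ p ∈ Finset.univ.filter fun p : ι × ι => p.1 ≠ p.2,
          (Finset.univ.filter fun f : ι → V => f p.1 = f p.2).card) * Fintype.card V :=
        Nat.mul_le_mul_right _ ((Finset.card_le_card hsub).trans Finset.card_biUnion_le)
    _ ≤ ∑ p ∈ Finset.univ.filter fun p : ι × ι => p.1 ≠ p.2,
          Fintype.card V ^ Fintype.card ι := by
        rw [Finset.sum_mul]
        refine Finset.sum_le_sum fun p hp => card_filter_apply_eq_mul_card_le ?_
        simpa using hp
    _ ≤ _ := by
        rw [Finset.sum_const, smul_eq_mul]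
        refine Nat.mul_le_mul_right _ ((Finset.card_le_univ _).trans ?_)
        rw [Fintype.card_prod, sq]

open scoped Classical in
/-- Every edge of a uniform hypergraph is the set of entries of some tuple. -/
theorem card_le_card_filter_image_mem {V : Type*} [Fintype V] [DecidableEq V] {h : ℕ}
    (H : Finset (Finset V)) (hH : ∀ e ∈ H, e.card = h) :
    H.card ≤ (Finset.univ.filter fun x : Fin h → V => Finset.univ.image x ∈ H).card := by
  refine Finset.card_le_card_of_surjOn (fun x => Finset.univ.image x) fun e he => ?_
  have himage : Finset.univ.image (fun i => ((e.equivFinOfCardEq (hH e he)).symm i : V)) = e := by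
    ext v
    simp only [Finset.mem_image, Finset.mem_univ, true_and]
    refine ⟨?_, fun hv => ⟨e.equivFinOfCardEq (hH e he) ⟨v, hv⟩, by simp⟩⟩
    rintro ⟨i, rfl⟩
    exact Subtype.coe_prop _
  refine ⟨_, ?_, himage⟩
  simp only [Finset.coe_filter, Finset.mem_univ, true_and, Set.mem_ofPred_eq]
  rwa [himage]

theorem pow_div_le_choose {n h : ℕ} (hn : 2 * h ≤ n) :
    (n : ℝ) ^ h / (2 ^ h * h.factorial) ≤ n.choose h := by
  refine le_trans ?_ (Nat.pow_le_choose (α := ℝ) h n)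
  rw [← div_div, ← div_pow]
  have hhalf : (n : ℝ) / 2 ≤ (n + 1 - h : ℕ) := by
    rw [Nat.cast_sub (by omega)]
    have : (2 : ℝ) * h ≤ n := by exact_mod_cast hn
    push_cast
    linarith
  gcongr


open scoped Classical in
/-- Hypergraph supersaturation (Erdős–Simonovits): an h-uniform hypergraph on n vertices with
at least α (n choose h) edges contains at least γ n^(hm) labeled copies of the complete
h-partite h-uniform hypergraph L_h(m), counted as injections f : Fin h × Fin m → Fin n such
that every transversal h-set is an edge. -/
theorem hypergraph_supersaturation (h m : ℕ) (hh : 0 < h) (hm : 0 < m)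
    (α : ℝ) (hα : 0 < α) :
    ∃ γ > (0 : ℝ), ∃ n0 : ℕ, ∀ n : ℕ, n0 ≤ n →
      ∀ H : Finset (Finset (Fin n)),
        (∀ e ∈ H, e.card = h) →
        α * (n.choose h : ℝ) ≤ (H.card : ℝ) →
        γ * (n : ℝ) ^ (h * m) ≤
          ((Finset.univ : Finset (Fin h × Fin m → Fin n)).filter
            (fun f => Function.Injective f ∧
              ∀ g : Fin h → Fin m,
                (Finset.univ.image (fun i => f (i, g i))) ∈ H)).card := by
  set δ : ℝ := α / (2 ^ h * h.factorial) with hδ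
  have hδpos : 0 < δ := by positivity
  set c : ℝ := δ ^ m ^ h with hc
  have hcpos : 0 < c := by positivity
  obtain ⟨n₁, hn₁⟩ := exists_nat_ge (2 * (h * m : ℝ) ^ 2 / c)
  refine ⟨c / 2, by positivity, max (max n₁ (2 * h)) 1, fun n hn H hH hcard => ?_⟩
  have hn1 : n₁ ≤ n := by omega
  have hn2 : 2 * h ≤ n := by omega
  have hn0 : 0 < n := by omega
  have : Nonempty (Fin n) := ⟨⟨0, hn0⟩⟩
  have hnpos : (0 : ℝ) < n := by exact_mod_cast hn0
  have hhom := pow_mul_pow_card_le_sum_prod m h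
    (fun x : Fin h → Fin n => if Finset.univ.image x ∈ H then (1 : ℝ) else 0)
    (fun x => by positivity) hδpos.le (by
      rw [Finset.sum_boole, Fintype.card_fin]
      calc δ * (n : ℝ) ^ h = α * ((n : ℝ) ^ h / (2 ^ h * h.factorial)) := by rw [hδ]; ring
        _ ≤ α * n.choose h := by gcongr; exact pow_div_le_choose hn2
        _ ≤ H.card := hcard
        _ ≤ _ := by exact_mod_cast card_le_card_filter_image_mem H hH)
  rw [← (Equiv.curry (Fin h) (Fin m) (Fin n)).sum_comp, Fintype.card_fin] at hhom
  simp only [Finset.prod_ite_zero, Finset.prod_const_one, Finset.sum_boole, Finset.mem_univ,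
    true_imp_iff, Equiv.curry_apply, Function.curry_apply] at hhom
  set A := (Finset.univ : Finset (Fin h × Fin m → Fin n)).filter
    (fun f => ∀ g : Fin h → Fin m, (Finset.univ.image (fun i => f (i, g i))) ∈ H)
  set B := (Finset.univ : Finset (Fin h × Fin m → Fin n)).filter
    (fun f => ¬ Function.Injective f)
  set C := (Finset.univ : Finset (Fin h × Fin m → Fin n)).filter
    (fun f => Function.Injective f ∧
      ∀ g : Fin h → Fin m, (Finset.univ.image (fun i => f (i, g i))) ∈ H)
  have hdeg : B.card * n ≤ (h * m) ^ 2 * n ^ (h * m) := by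
    have hle := card_filter_not_injective_mul_card_le (Fin h × Fin m) (Fin n)
    rw [Fintype.card_prod, Fintype.card_fin, Fintype.card_fin, Fintype.card_fin] at hle
    convert hle
  have hABC : (A.card : ℝ) ≤ C.card + B.card := by
    have hsub : A ⊆ C ∪ B := fun f hf => by
      by_cases hinj : Function.Injective f <;> simp_all [A, B, C]
    exact_mod_cast (Finset.card_le_card hsub).trans (Finset.card_union_le _ _)
  have hB : (B.card : ℝ) ≤ c / 2 * (n : ℝ) ^ (h * m) := by
    have h1 : (B.card : ℝ) * n ≤ (h * m : ℝ) ^ 2 * (n : ℝ) ^ (h * m) := by exact_mod_cast hdeg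
    have h2 : (h * m : ℝ) ^ 2 ≤ c / 2 * n := by
      have h3 := hn₁.trans (Nat.cast_le.2 hn1)
      rw [div_le_iff₀ hcpos] at h3
      linarith
    refine le_of_mul_le_mul_right ?_ hnpos
    calc (B.card : ℝ) * n ≤ _ := h1
      _ ≤ c / 2 * n * (n : ℝ) ^ (h * m) := by gcongr
      _ = _ := by ring
  have hA : c * (n : ℝ) ^ (h * m) ≤ A.card := by exact_mod_cast hhom
  linarith
end
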